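/- arXiv:1412.2679 — 9 statements merged into one kernel-verified Lean document; each statement's English description precedes it below -/
import Mathlib

section
/- Fix i ∈ {1,…,N}, x ∈ Γ and p ∈ ℝe_0 + ℝeᵢ, and define φ_{i,x,p}(δ) = Hᵢ(x, p + δeᵢ) and Δ_{i,x,p} = {δ ∈ ℝ : φ_{i,x,p}(δ) = min_{d∈ℝ} φ_{i,x,p}(d)}. Then δ ∈ Δ_{i,x,p} if and only if there exists a* ∈ Aᵢ such that fᵢ(x,a*)·eᵢ = 0 and φ_{i,x,p}(δ) = −fᵢ(x,a*)·p − ℓᵢ(x,a*). -/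
open scoped RealInnerProductSpace
open Set Metric MeasureTheory

noncomputable section

abbrev E3 : Type := EuclideanSpace ℝ (Fin 3)

/-- The closed half-plane `ℝ e0 × ℝ₊ ei`. -/
def halfPlane (e0 ei : E3) : Set E3 :=
  {x | ∃ x0 xi : ℝ, 0 ≤ xi ∧ x = x0 • e0 + xi • ei}

/-- The interface `Γ = ℝ e0`. -/
def iface (e0 : E3) : Set E3 := {x | ∃ t : ℝ, x = t • e0}

/-- The junction `S = ⋃ i Pᵢ`. -/
def junction (N : ℕ) (e0 : E3) (e : Fin N → E3) : Set E3 :=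
  ⋃ i, halfPlane e0 (e i)

/-- If a compact convex planar set meets the axis `{0} × ℝ`, and meets every half-plane
`{z | M ≤ z.2 - d * z.1}`, then it meets the ray `{0} × [M, ∞)`. -/
theorem exists_mem_fst_eq_zero_of_forall_exists_le {K : Set (ℝ × ℝ)} (hconv : Convex ℝ K)
    (hcomp : IsCompact K) (hzero : ∃ z ∈ K, z.1 = 0) {M : ℝ}
    (hM : ∀ d : ℝ, ∃ z ∈ K, M ≤ z.2 - d * z.1) :
    ∃ z ∈ K, z.1 = 0 ∧ M ≤ z.2 := by
  by_contra! hcon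
  have hdisj : Disjoint K (({0} : Set ℝ) ×ˢ Ici M) := by
    rw [Set.disjoint_left]
    rintro z hzK ⟨hz1, hz2⟩
    exact (hcon z hzK hz1).not_ge hz2
  obtain ⟨g, u, v, hgK, huv, hgray⟩ := geometric_hahn_banach_compact_closed hconv hcomp
    ((convex_singleton (0 : ℝ)).prod (convex_Ici M)) (isClosed_singleton.prod isClosed_Ici) hdisj
  have hg (z : ℝ × ℝ) : g z = z.1 * g (1, 0) + z.2 * g (0, 1) := by
    rw [← smul_eq_mul, ← smul_eq_mul, ← map_smul, ← map_smul, ← map_add]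
    simp
  have hv : v < M * g (0, 1) := by
    simpa [hg (0, M)] using hgray (0, M) ⟨rfl, self_mem_Ici⟩
  obtain ⟨z₀, hz₀K, hz₀⟩ := hzero
  have hpos : 0 < g (0, 1) := by
    have h₁ := hgK z₀ hz₀K
    rw [hg, hz₀, zero_mul, zero_add] at h₁
    have h₂ := hcon z₀ hz₀K hz₀
    by_contra! h
    nlinarith
  obtain ⟨z, hzK, hz⟩ := hM (-(g (1, 0) / g (0, 1)))
  have h₁ := hgK z hzK
  rw [hg] at h₁
  have h₂ := mul_le_mul_of_nonneg_right hz hpos.le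
  have h₃ : (z.2 - -(g (1, 0) / g (0, 1)) * z.1) * g (0, 1)
      = z.1 * g (1, 0) + z.2 * g (0, 1) := by
    field_simp
    ring
  linarith

/-- Characterization of the minimizers of `δ ↦ Hᵢ(x, p + δ eᵢ)`. -/
theorem stmt_2
    (N : ℕ) (hN : 2 ≤ N) (e0 : E3) (e : Fin N → E3)
    (he0 : ‖e0‖ = 1) (he : ∀ k, ‖e k‖ = 1)
    (heinj : Function.Injective e) (hee0 : ∀ k, e k ≠ e0)
    (horth : ∀ k, ⟪e k, e0⟫ = 0)
    {A : Type} [MetricSpace A] (Ai : Fin N → Set A)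
    (hAne : ∀ k, (Ai k).Nonempty) (hAcp : ∀ k, IsCompact (Ai k))
    (hAdisj : ∀ k l, k ≠ l → Disjoint (Ai k) (Ai l))
    (f : Fin N → E3 → A → E3) (Mf Lf : ℝ)
    (hfcont : ∀ k, ContinuousOn (fun q : E3 × A => f k q.1 q.2)
      ((halfPlane e0 (e k)) ×ˢ (Ai k)))
    (hfplane : ∀ k, ∀ x ∈ halfPlane e0 (e k), ∀ a ∈ Ai k,
      ∃ c0 ci : ℝ, f k x a = c0 • e0 + ci • e k)
    (hfbdd : ∀ k, ∀ x ∈ halfPlane e0 (e k), ∀ a ∈ Ai k, ‖f k x a‖ ≤ Mf)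
    (hflip : ∀ k, ∀ x ∈ halfPlane e0 (e k), ∀ y ∈ halfPlane e0 (e k), ∀ a ∈ Ai k,
      ‖f k x a - f k y a‖ ≤ Lf * ‖x - y‖)
    (ℓ : Fin N → E3 → A → ℝ) (Mℓ : ℝ) (ω : ℝ → ℝ)
    (hωmono : Monotone ω) (hω0 : ω 0 = 0)
    (hlcont : ∀ k, ContinuousOn (fun q : E3 × A => ℓ k q.1 q.2)
      ((halfPlane e0 (e k)) ×ˢ (Ai k)))
    (hlbdd : ∀ k, ∀ x ∈ halfPlane e0 (e k), ∀ a ∈ Ai k, |ℓ k x a| ≤ Mℓ)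
    (hlmod : ∀ k, ∀ x ∈ halfPlane e0 (e k), ∀ y ∈ halfPlane e0 (e k), ∀ a ∈ Ai k,
      |ℓ k x a - ℓ k y a| ≤ ω ‖x - y‖)
    (hH2 : ∀ k, ∀ x ∈ halfPlane e0 (e k),
      Convex ℝ {q : E3 × ℝ | ∃ a ∈ Ai k, q = (f k x a, ℓ k x a)})
    (δ : ℝ) (hδ : 0 < δ)
    (hH3 : ∀ k, ∀ x ∈ iface e0, ∀ w : E3, ‖w‖ < δ →
      (∃ c0 ci : ℝ, w = c0 • e0 + ci • e k) → ∃ a ∈ Ai k, f k x a = w)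
    (H : Fin N → E3 → E3 → ℝ)
    (hH : ∀ k, ∀ x ∈ halfPlane e0 (e k), ∀ p : E3,
      IsGreatest {v : ℝ | ∃ a ∈ Ai k, v = -⟪p, f k x a⟫ - ℓ k x a} (H k x p))
    (i : Fin N) (x : E3) (hx : x ∈ iface e0)
    (p : E3) (hp : ∃ p0 pi : ℝ, p = p0 • e0 + pi • e i) (δm : ℝ) :
    (∀ d : ℝ, H i x (p + δm • e i) ≤ H i x (p + d • e i)) ↔
      ∃ a ∈ Ai i, ⟪f i x a, e i⟫ = 0 ∧
        H i x (p + δm • e i) = -⟪p, f i x a⟫ - ℓ i x a := by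
  have hxP : x ∈ halfPlane e0 (e i) := by
    obtain ⟨t, rfl⟩ := hx
    exact ⟨t, 0, le_rfl, by simp⟩
  have hinner (d : ℝ) (w : E3) : ⟪p + d • e i, w⟫ = ⟪p, w⟫ + d * ⟪w, e i⟫ := by
    rw [inner_add_left, real_inner_smul_left, real_inner_comm w (e i)]
  constructor
  · intro hmin
    have hmaps : MapsTo (fun a : A => (x, a)) (Ai i) (halfPlane e0 (e i) ×ˢ Ai i) :=
      fun a ha => ⟨hxP, ha⟩
    have hf : ContinuousOn (fun a => f i x a) (Ai i) :=
      (hfcont i).comp (by fun_prop) hmaps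
    have hl : ContinuousOn (fun a => ℓ i x a) (Ai i) :=
      (hlcont i).comp (by fun_prop) hmaps
    have hcomp : IsCompact ((fun a => (⟪f i x a, e i⟫, -⟪p, f i x a⟫ - ℓ i x a)) '' Ai i) :=
      (hAcp i).image_of_continuousOn <| (hf.inner continuousOn_const).prodMk
        ((continuousOn_const.inner hf).neg.sub hl)
    have hconv : Convex ℝ ((fun a => (⟪f i x a, e i⟫, -⟪p, f i x a⟫ - ℓ i x a)) '' Ai i) := by
      have hlin : IsLinearMap ℝ
          (fun q : E3 × ℝ => ((⟪q.1, e i⟫, -⟪p, q.1⟫ - q.2) : ℝ × ℝ)) := by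
        constructor
        · intro q r
          ext <;> simp only [Prod.fst_add, Prod.snd_add, inner_add_left, inner_add_right]
          ring
        · intro c q
          ext <;> simp only [Prod.smul_fst, Prod.smul_snd, real_inner_smul_left,
            real_inner_smul_right, smul_eq_mul]
          ring
      have himage : (fun a => (⟪f i x a, e i⟫, -⟪p, f i x a⟫ - ℓ i x a)) '' Ai i =
          (fun q : E3 × ℝ => ((⟪q.1, e i⟫, -⟪p, q.1⟫ - q.2) : ℝ × ℝ)) ''
            {q | ∃ a ∈ Ai i, q = (f i x a, ℓ i x a)} := by
        ext z
        constructor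
        · rintro ⟨a, ha, rfl⟩
          exact ⟨_, ⟨a, ha, rfl⟩, rfl⟩
        · rintro ⟨_, ⟨a, ha, rfl⟩, rfl⟩
          exact ⟨a, ha, rfl⟩
      rw [himage]
      exact (hH2 i x hxP).is_linear_image hlin
    obtain ⟨a₀, ha₀, hfa₀⟩ := hH3 i x hx 0 (by simpa using hδ) ⟨0, 0, by simp⟩
    obtain ⟨_, ⟨a, ha, rfl⟩, hfst, hsnd⟩ :=
      exists_mem_fst_eq_zero_of_forall_exists_le (M := H i x (p + δm • e i)) hconv hcomp
        ⟨_, ⟨a₀, ha₀, rfl⟩, by simp [hfa₀]⟩ fun d => by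
          obtain ⟨a, ha, hmax⟩ := (hH i x hxP (p + d • e i)).1
          refine ⟨_, ⟨a, ha, rfl⟩, ?_⟩
          have h := hmin d
          rw [hmax, hinner d] at h
          dsimp only
          linarith
    dsimp only at hfst hsnd
    refine ⟨a, ha, hfst, hsnd.antisymm ?_⟩
    refine (hH i x hxP (p + δm • e i)).2 ⟨a, ha, ?_⟩
    rw [hinner, hfst, mul_zero, add_zero]
  · rintro ⟨a, ha, hfa, hval⟩ d
    rw [hval]
    refine (hH i x hxP (p + d • e i)).2 ⟨a, ha, ?_⟩
    rw [hinner, hfa, mul_zero, add_zero]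
end
end

section
/- Fix i ∈ {1,…,N}, x ∈ Γ and p = p₀e₀ + pᵢeᵢ with p₀, pᵢ ∈ ℝ, and define φ_{i,x,p}(δ) = Hᵢ(x, p + δeᵢ) and Δ_{i,x,p} = {δ ∈ ℝ : φ_{i,x,p}(δ) = min_{d∈ℝ} φ_{i,x,p}(d)}. Then: (1) for every δ ∈ Δ_{i,x,p}, Hᵢ(x, p + δeᵢ) = Hᵢ⁺(x, p + δeᵢ) = H_{Γ,i}^T(x, p₀e₀); and (2) for every δ ≥ min{d : d ∈ Δ_{i,x,p}}, Hᵢ⁺(x, p + δeᵢ) = H_{Γ,i}^T(x, p₀e₀). -/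
open scoped RealInnerProductSpace
open Set Metric MeasureTheory

noncomputable section

/-- If the support-type function `d ↦ max (-⟪p + d • e, v⟫ - l)` of a convex set `S` of pairs
`(v, l)` is minimal at `dm`, then its minimum is approached by points of `S` tangential to `e`. -/
theorem exists_tangential_of_minimizer {E : Type*} [NormedAddCommGroup E] [InnerProductSpace ℝ E]
    {S : Set (E × ℝ)} (hS : Convex ℝ S) {e p : E} {K : ℝ} (hK : ∀ q ∈ S, |⟪q.1, e⟫| ≤ K)
    {φ : ℝ → ℝ} (hφ : ∀ d, IsGreatest ((fun q : E × ℝ => -⟪p + d • e, q.1⟫ - q.2) '' S) (φ d))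
    {dm : ℝ} (hmin : ∀ d, φ dm ≤ φ d) {ε : ℝ} (hε : 0 < ε) :
    ∃ q ∈ S, ⟪q.1, e⟫ = 0 ∧ φ dm - ε * K ≤ -⟪p, q.1⟫ - q.2 := by
  have shift : ∀ t : ℝ, ∃ q ∈ S, φ dm ≤ -⟪p + dm • e, q.1⟫ - q.2 - t * ⟪q.1, e⟫ ∧
      -⟪p + dm • e, q.1⟫ - q.2 ≤ φ dm := by
    intro t
    obtain ⟨q, hq, hval⟩ := (hφ (dm + t)).1
    refine ⟨q, hq, ?_, (hφ dm).2 ⟨q, hq, rfl⟩⟩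
    have h := hmin (dm + t)
    simp only [← hval, inner_add_left, real_inner_smul_left, real_inner_comm q.1 e] at h ⊢
    linarith
  obtain ⟨q₁, hq₁, hge₁, hle₁⟩ := shift ε
  obtain ⟨q₂, hq₂, hge₂, hle₂⟩ := shift (-ε)
  have hs₁ : ⟪q₁.1, e⟫ ≤ 0 := by nlinarith
  have hs₂ : 0 ≤ ⟪q₂.1, e⟫ := by nlinarith
  have hb₁ := mul_le_mul_of_nonneg_left (abs_le.1 (hK q₁ hq₁)).1 hε.le
  have hb₂ := mul_le_mul_of_nonneg_left (abs_le.1 (hK q₂ hq₂)).2 hε.le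
  have hval₁ : φ dm - ε * K ≤ -⟪p + dm • e, q₁.1⟫ - q₁.2 := by linarith
  have hval₂ : φ dm - ε * K ≤ -⟪p + dm • e, q₂.1⟫ - q₂.2 := by linarith
  have hlin : IsLinearMap ℝ (fun q : E × ℝ => -⟪p + dm • e, q.1⟫ - q.2) :=
    ⟨fun x y => by simp only [Prod.fst_add, Prod.snd_add, inner_add_right]; ring,
      fun c x => by
        simp only [Prod.smul_fst, Prod.smul_snd, real_inner_smul_right, smul_eq_mul]; ring⟩
  have hlin' : IsLinearMap ℝ (fun q : E × ℝ => ⟪q.1, e⟫) :=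
    ⟨fun x y => by simp only [Prod.fst_add, inner_add_left],
      fun c x => by simp only [Prod.smul_fst, real_inner_smul_left, smul_eq_mul]⟩
  have hconv := (hS.inter (convex_halfSpace_ge hlin (φ dm - ε * K))).is_linear_image hlin'
  obtain ⟨q, ⟨hq, hge⟩, hzero⟩ := hconv.ordConnected.out
    (mem_image_of_mem _ ⟨hq₁, hval₁⟩) (mem_image_of_mem _ ⟨hq₂, hval₂⟩) ⟨hs₁, hs₂⟩
  refine ⟨q, hq, hzero, ?_⟩
  have hzero' : ⟪e, q.1⟫ = 0 := by rw [real_inner_comm]; exact hzero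
  simpa only [mem_ofPred_eq, inner_add_left, real_inner_smul_left, hzero', mul_zero, add_zero]
    using hge

/-- At minimizers `Hᵢ = Hᵢ⁺ = H_{Γ,i}^T`, and `Hᵢ⁺` is constant above the least
minimizer. -/
theorem stmt_3
    (N : ℕ) (hN : 2 ≤ N) (e0 : E3) (e : Fin N → E3)
    (he0 : ‖e0‖ = 1) (he : ∀ k, ‖e k‖ = 1)
    (heinj : Function.Injective e) (hee0 : ∀ k, e k ≠ e0)
    (horth : ∀ k, ⟪e k, e0⟫ = 0)
    {A : Type} [MetricSpace A] (Ai : Fin N → Set A)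
    (hAne : ∀ k, (Ai k).Nonempty) (hAcp : ∀ k, IsCompact (Ai k))
    (hAdisj : ∀ k l, k ≠ l → Disjoint (Ai k) (Ai l))
    (f : Fin N → E3 → A → E3) (Mf Lf : ℝ)
    (hfcont : ∀ k, ContinuousOn (fun q : E3 × A => f k q.1 q.2)
      ((halfPlane e0 (e k)) ×ˢ (Ai k)))
    (hfplane : ∀ k, ∀ x ∈ halfPlane e0 (e k), ∀ a ∈ Ai k,
      ∃ c0 ci : ℝ, f k x a = c0 • e0 + ci • e k)
    (hfbdd : ∀ k, ∀ x ∈ halfPlane e0 (e k), ∀ a ∈ Ai k, ‖f k x a‖ ≤ Mf)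
    (hflip : ∀ k, ∀ x ∈ halfPlane e0 (e k), ∀ y ∈ halfPlane e0 (e k), ∀ a ∈ Ai k,
      ‖f k x a - f k y a‖ ≤ Lf * ‖x - y‖)
    (ℓ : Fin N → E3 → A → ℝ) (Mℓ : ℝ) (ω : ℝ → ℝ)
    (hωmono : Monotone ω) (hω0 : ω 0 = 0)
    (hlcont : ∀ k, ContinuousOn (fun q : E3 × A => ℓ k q.1 q.2)
      ((halfPlane e0 (e k)) ×ˢ (Ai k)))
    (hlbdd : ∀ k, ∀ x ∈ halfPlane e0 (e k), ∀ a ∈ Ai k, |ℓ k x a| ≤ Mℓ)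
    (hlmod : ∀ k, ∀ x ∈ halfPlane e0 (e k), ∀ y ∈ halfPlane e0 (e k), ∀ a ∈ Ai k,
      |ℓ k x a - ℓ k y a| ≤ ω ‖x - y‖)
    (hH2 : ∀ k, ∀ x ∈ halfPlane e0 (e k),
      Convex ℝ {q : E3 × ℝ | ∃ a ∈ Ai k, q = (f k x a, ℓ k x a)})
    (δ : ℝ) (hδ : 0 < δ)
    (hH3 : ∀ k, ∀ x ∈ iface e0, ∀ w : E3, ‖w‖ < δ →
      (∃ c0 ci : ℝ, w = c0 • e0 + ci • e k) → ∃ a ∈ Ai k, f k x a = w)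
    (H : Fin N → E3 → E3 → ℝ)
    (hH : ∀ k, ∀ x ∈ halfPlane e0 (e k), ∀ p : E3,
      IsGreatest {v : ℝ | ∃ a ∈ Ai k, v = -⟪p, f k x a⟫ - ℓ k x a} (H k x p))
    (Hp : Fin N → E3 → E3 → ℝ)
    (hHp : ∀ k, ∀ x ∈ iface e0, ∀ p : E3,
      IsGreatest {v : ℝ | ∃ a ∈ Ai k, 0 ≤ ⟪f k x a, e k⟫ ∧ v = -⟪p, f k x a⟫ - ℓ k x a}
        (Hp k x p))
    (HT : Fin N → E3 → E3 → ℝ)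
    (hHT : ∀ k, ∀ x ∈ iface e0, ∀ p : E3,
      IsGreatest {v : ℝ | ∃ a ∈ Ai k, ⟪f k x a, e k⟫ = 0 ∧ v = -⟪p, f k x a⟫ - ℓ k x a}
        (HT k x p))
    (i : Fin N) (x : E3) (hx : x ∈ iface e0) (p0 pi : ℝ) :
    (∀ δm : ℝ,
      (∀ d : ℝ, H i x ((p0 • e0 + pi • e i) + δm • e i)
          ≤ H i x ((p0 • e0 + pi • e i) + d • e i)) →
      H i x ((p0 • e0 + pi • e i) + δm • e i)
          = Hp i x ((p0 • e0 + pi • e i) + δm • e i) ∧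
        Hp i x ((p0 • e0 + pi • e i) + δm • e i) = HT i x (p0 • e0)) ∧
    (∀ δmin : ℝ,
      IsLeast {d : ℝ | ∀ d' : ℝ, H i x ((p0 • e0 + pi • e i) + d • e i)
          ≤ H i x ((p0 • e0 + pi • e i) + d' • e i)} δmin →
      ∀ δm : ℝ, δmin ≤ δm →
        Hp i x ((p0 • e0 + pi • e i) + δm • e i) = HT i x (p0 • e0)) := by
  have hxP : x ∈ halfPlane e0 (e i) := by
    obtain ⟨t, rfl⟩ := hx
    exact ⟨t, 0, le_rfl, by simp⟩
  have value_of_tangential : ∀ d : ℝ, ∀ v : E3, ⟪v, e i⟫ = 0 →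
      ⟪(p0 • e0 + pi • e i) + d • e i, v⟫ = ⟪p0 • e0, v⟫ := by
    intro d v hv
    rw [real_inner_comm] at hv
    simp [inner_add_left, real_inner_smul_left, hv]
  have HT_le_Hp : ∀ d : ℝ,
      HT i x (p0 • e0) ≤ Hp i x ((p0 • e0 + pi • e i) + d • e i) := by
    intro d
    obtain ⟨a, ha, hs, hv⟩ := (hHT i x hx (p0 • e0)).1
    exact (hHp i x hx _).2 ⟨a, ha, hs.ge, by rw [hv, value_of_tangential d _ hs]⟩
  have Hp_le_H : ∀ p : E3, Hp i x p ≤ H i x p := by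
    intro p
    obtain ⟨a, ha, -, hv⟩ := (hHp i x hx p).1
    exact (hH i x hxP p).2 ⟨a, ha, hv⟩
  have Hp_antitone : ∀ d d' : ℝ, d ≤ d' →
      Hp i x ((p0 • e0 + pi • e i) + d' • e i) ≤ Hp i x ((p0 • e0 + pi • e i) + d • e i) := by
    intro d d' hd
    obtain ⟨a, ha, hs, hv⟩ := (hHp i x hx ((p0 • e0 + pi • e i) + d' • e i)).1
    have h := (hHp i x hx ((p0 • e0 + pi • e i) + d • e i)).2 ⟨a, ha, hs, rfl⟩
    refine le_trans ?_ h
    have hmul := mul_le_mul_of_nonneg_right hd hs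
    rw [hv, inner_add_left _ (d' • e i), inner_add_left _ (d • e i), real_inner_smul_left,
      real_inner_smul_left, real_inner_comm (f i x a) (e i)]
    linarith
  have H_le_HT : ∀ δm : ℝ,
      (∀ d : ℝ, H i x ((p0 • e0 + pi • e i) + δm • e i)
        ≤ H i x ((p0 • e0 + pi • e i) + d • e i)) →
      H i x ((p0 • e0 + pi • e i) + δm • e i) ≤ HT i x (p0 • e0) := by
    intro δm hmin
    have hK : ∀ q ∈ {q : E3 × ℝ | ∃ a ∈ Ai i, q = (f i x a, ℓ i x a)},
        |⟪q.1, e i⟫| ≤ |Mf| + 1 := by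
      rintro _ ⟨a, ha, rfl⟩
      have h := abs_real_inner_le_norm (f i x a) (e i)
      rw [he i, mul_one] at h
      linarith [hfbdd i x hxP a ha, le_abs_self Mf]
    have hφ : ∀ d : ℝ, IsGreatest
        ((fun q : E3 × ℝ => -⟪(p0 • e0 + pi • e i) + d • e i, q.1⟫ - q.2) ''
          {q : E3 × ℝ | ∃ a ∈ Ai i, q = (f i x a, ℓ i x a)})
        (H i x ((p0 • e0 + pi • e i) + d • e i)) := by
      intro d
      convert hH i x hxP ((p0 • e0 + pi • e i) + d • e i) using 1
      ext v
      constructor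
      · rintro ⟨_, ⟨a, ha, rfl⟩, rfl⟩
        exact ⟨a, ha, rfl⟩
      · rintro ⟨a, ha, rfl⟩
        exact ⟨_, ⟨a, ha, rfl⟩, rfl⟩
    have hpos : 0 < |Mf| + 1 := by positivity
    refine le_of_forall_pos_le_add fun ε hε => ?_
    obtain ⟨_, ⟨a, ha, rfl⟩, hs, hv⟩ :=
      exists_tangential_of_minimizer (hH2 i x hxP) hK hφ hmin (div_pos hε hpos)
    have hT := (hHT i x hx (p0 • e0)).2 ⟨a, ha, hs, rfl⟩
    have hval := value_of_tangential 0 _ hs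
    rw [zero_smul, add_zero] at hval
    rw [div_mul_cancel₀ _ hpos.ne', hval] at hv
    linarith
  refine ⟨fun δm hmin => ?_, fun δmin hleast δm hle => ?_⟩
  · have h := H_le_HT δm hmin
    exact ⟨le_antisymm (h.trans (HT_le_Hp δm)) (Hp_le_H _),
      le_antisymm ((Hp_le_H _).trans h) (HT_le_Hp δm)⟩
  · exact le_antisymm
      ((Hp_antitone _ _ hle).trans ((Hp_le_H _).trans (H_le_HT δmin hleast.1))) (HT_le_Hp δm)
end
end

section
/- There exists a positive real number R > 0 such that for all i = 1,…,N and all x ∈ B(Γ,R) ∩ Pᵢ, [−δ/2, δ/2] ⊆ {fᵢ(x,a)·eᵢ : a ∈ Aᵢ}; that is, the normal controllability assumption [tH3] propagates with constant δ/2 to a neighborhood of the interface Γ. -/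
open scoped RealInnerProductSpace
open Set Metric MeasureTheory

noncomputable section

theorem iface_subset_halfPlane (e0 ei : E3) : iface e0 ⊆ halfPlane e0 ei := by
  rintro x ⟨t, rfl⟩
  exact ⟨t, 0, le_rfl, by simp⟩

theorem iface_nonempty (e0 : E3) : (iface e0).Nonempty := ⟨0, 0, by simp⟩

/-- The values of a linear functional along the first component of a convex graph form an
interval. -/
theorem ordConnected_inner_of_convex_graph {A E : Type*} [NormedAddCommGroup E]
    [InnerProductSpace ℝ E] (s : Set A) (g : A → E) (l : A → ℝ) (v : E)
    (h : Convex ℝ {q : E × ℝ | ∃ a ∈ s, q = (g a, l a)}) :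
    ((fun a => ⟪g a, v⟫) '' s).OrdConnected := by
  have h' := h.linear_image ((innerSL ℝ v).toLinearMap ∘ₗ LinearMap.fst ℝ E ℝ)
  have key : (fun a => ⟪g a, v⟫) '' s = ((innerSL ℝ v).toLinearMap ∘ₗ LinearMap.fst ℝ E ℝ) ''
      {q : E × ℝ | ∃ a ∈ s, q = (g a, l a)} := by
    ext r
    constructor
    · rintro ⟨a, ha, rfl⟩
      exact ⟨_, ⟨a, ha, rfl⟩, by simp [real_inner_comm]⟩
    · rintro ⟨_, ⟨a, ha, rfl⟩, rfl⟩
      exact ⟨a, ha, by simp [real_inner_comm]⟩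
  rw [key]
  exact h'.ordConnected

/-- Normal controllability [tH3] propagates with constant `δ/2` to a neighborhood
`B(Γ,R)` of the interface. -/
theorem stmt_5
    (N : ℕ) (hN : 2 ≤ N) (e0 : E3) (e : Fin N → E3)
    (he0 : ‖e0‖ = 1) (he : ∀ k, ‖e k‖ = 1)
    (heinj : Function.Injective e) (hee0 : ∀ k, e k ≠ e0)
    (horth : ∀ k, ⟪e k, e0⟫ = 0)
    {A : Type} [MetricSpace A] (Ai : Fin N → Set A)
    (hAne : ∀ k, (Ai k).Nonempty) (hAcp : ∀ k, IsCompact (Ai k))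
    (hAdisj : ∀ k l, k ≠ l → Disjoint (Ai k) (Ai l))
    (f : Fin N → E3 → A → E3) (Mf Lf : ℝ)
    (hfcont : ∀ k, ContinuousOn (fun q : E3 × A => f k q.1 q.2)
      ((halfPlane e0 (e k)) ×ˢ (Ai k)))
    (hfplane : ∀ k, ∀ x ∈ halfPlane e0 (e k), ∀ a ∈ Ai k,
      ∃ c0 ci : ℝ, f k x a = c0 • e0 + ci • e k)
    (hfbdd : ∀ k, ∀ x ∈ halfPlane e0 (e k), ∀ a ∈ Ai k, ‖f k x a‖ ≤ Mf)
    (hflip : ∀ k, ∀ x ∈ halfPlane e0 (e k), ∀ y ∈ halfPlane e0 (e k), ∀ a ∈ Ai k,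
      ‖f k x a - f k y a‖ ≤ Lf * ‖x - y‖)
    (ℓ : Fin N → E3 → A → ℝ)
    (hH2 : ∀ k, ∀ x ∈ halfPlane e0 (e k),
      Convex ℝ {q : E3 × ℝ | ∃ a ∈ Ai k, q = (f k x a, ℓ k x a)})
    (δ : ℝ) (hδ : 0 < δ)
    (htH3 : ∀ k, ∀ x ∈ iface e0, ∀ s ∈ Icc (-δ) δ,
      ∃ a ∈ Ai k, ⟪f k x a, e k⟫ = s)
 :
    ∃ R : ℝ, 0 < R ∧ ∀ i : Fin N, ∀ x ∈ halfPlane e0 (e i),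
      Metric.infDist x (iface e0) < R →
      ∀ s ∈ Icc (-(δ / 2)) (δ / 2), ∃ a ∈ Ai i, ⟪f i x a, e i⟫ = s := by
  have hL : 0 < |Lf| + 1 := by positivity
  refine ⟨δ / 2 / (|Lf| + 1), by positivity, fun i x hx hxR s hs => ?_⟩
  obtain ⟨y, hy, hxy⟩ := (Metric.infDist_lt_iff (iface_nonempty e0)).1 hxR
  rw [lt_div_iff₀ hL, dist_eq_norm] at hxy
  have hclose : ∀ a ∈ Ai i, |⟪f i x a, e i⟫ - ⟪f i y a, e i⟫| ≤ δ / 2 := fun a ha =>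
    calc |⟪f i x a, e i⟫ - ⟪f i y a, e i⟫| = |⟪f i x a - f i y a, e i⟫| := by
          rw [inner_sub_left]
      _ ≤ ‖f i x a - f i y a‖ * ‖e i‖ := abs_real_inner_le_norm _ _
      _ ≤ Lf * ‖x - y‖ := by
          simpa [he i] using hflip i x hx y (iface_subset_halfPlane e0 (e i) hy) a ha
      _ ≤ δ / 2 := by nlinarith [le_abs_self Lf, norm_nonneg (x - y)]
  obtain ⟨a, ha, hya⟩ := htH3 i y hy (-δ) ⟨le_rfl, by linarith⟩
  obtain ⟨b, hb, hyb⟩ := htH3 i y hy δ ⟨by linarith, le_rfl⟩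
  have h1 := abs_le.1 (hclose a ha)
  have h2 := abs_le.1 (hclose b hb)
  exact (ordConnected_inner_of_convex_graph (Ai i) (f i x) (ℓ i x) (e i) (hH2 i x hx)).out
    ⟨a, ha, rfl⟩ ⟨b, hb, rfl⟩ ⟨by linarith [h1.2, hs.1], by linarith [h2.1, hs.2]⟩
end
end

section
/- Set M = L_f(1 + 2M_f δ⁻¹) and ω(t) = ω_ℓ(t) + 2M_ℓ L_f δ⁻¹ t for t ≥ 0. Then for any x, x' ∈ Γ, any i ∈ {1,…,N} and any a ∈ Aᵢ with fᵢ(x,a)·eᵢ ≥ 0, there exists a' ∈ Aᵢ such that fᵢ(x',a')·eᵢ ≥ 0, |fᵢ(x,a) − fᵢ(x',a')| ≤ M|x−x'|, and |ℓᵢ(x,a) − ℓᵢ(x',a')| ≤ ω(|x−x'|). -/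
open scoped RealInnerProductSpace
open Set Metric MeasureTheory

noncomputable section

/-- Matching of inward controls at two points of the interface, with explicit
constants `M = L_f (1 + 2 M_f δ⁻¹)` and `ω(t) = ω_ℓ(t) + 2 M_ℓ L_f δ⁻¹ t`. -/
theorem stmt_8
    (N : ℕ) (hN : 2 ≤ N) (e0 : E3) (e : Fin N → E3)
    (he0 : ‖e0‖ = 1) (he : ∀ k, ‖e k‖ = 1)
    (heinj : Function.Injective e) (hee0 : ∀ k, e k ≠ e0)
    (horth : ∀ k, ⟪e k, e0⟫ = 0)
    {A : Type} [MetricSpace A] (Ai : Fin N → Set A)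
    (hAne : ∀ k, (Ai k).Nonempty) (hAcp : ∀ k, IsCompact (Ai k))
    (hAdisj : ∀ k l, k ≠ l → Disjoint (Ai k) (Ai l))
    (f : Fin N → E3 → A → E3) (Mf Lf : ℝ)
    (hfcont : ∀ k, ContinuousOn (fun q : E3 × A => f k q.1 q.2)
      ((halfPlane e0 (e k)) ×ˢ (Ai k)))
    (hfplane : ∀ k, ∀ x ∈ halfPlane e0 (e k), ∀ a ∈ Ai k,
      ∃ c0 ci : ℝ, f k x a = c0 • e0 + ci • e k)
    (hfbdd : ∀ k, ∀ x ∈ halfPlane e0 (e k), ∀ a ∈ Ai k, ‖f k x a‖ ≤ Mf)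
    (hflip : ∀ k, ∀ x ∈ halfPlane e0 (e k), ∀ y ∈ halfPlane e0 (e k), ∀ a ∈ Ai k,
      ‖f k x a - f k y a‖ ≤ Lf * ‖x - y‖)
    (ℓ : Fin N → E3 → A → ℝ) (Mℓ : ℝ) (ω : ℝ → ℝ)
    (hωmono : Monotone ω) (hω0 : ω 0 = 0)
    (hlcont : ∀ k, ContinuousOn (fun q : E3 × A => ℓ k q.1 q.2)
      ((halfPlane e0 (e k)) ×ˢ (Ai k)))
    (hlbdd : ∀ k, ∀ x ∈ halfPlane e0 (e k), ∀ a ∈ Ai k, |ℓ k x a| ≤ Mℓ)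
    (hlmod : ∀ k, ∀ x ∈ halfPlane e0 (e k), ∀ y ∈ halfPlane e0 (e k), ∀ a ∈ Ai k,
      |ℓ k x a - ℓ k y a| ≤ ω ‖x - y‖)
    (hH2 : ∀ k, ∀ x ∈ halfPlane e0 (e k),
      Convex ℝ {q : E3 × ℝ | ∃ a ∈ Ai k, q = (f k x a, ℓ k x a)})
    (δ : ℝ) (hδ : 0 < δ)
    (htH3 : ∀ k, ∀ x ∈ iface e0, ∀ s ∈ Icc (-δ) δ,
      ∃ a ∈ Ai k, ⟪f k x a, e k⟫ = s)
    (x : E3) (hx : x ∈ iface e0) (x' : E3) (hx' : x' ∈ iface e0)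
    (i : Fin N) (a : A) (ha : a ∈ Ai i) (hin : 0 ≤ ⟪f i x a, e i⟫) :
    ∃ a' ∈ Ai i, 0 ≤ ⟪f i x' a', e i⟫ ∧
      ‖f i x a - f i x' a'‖ ≤ Lf * (1 + 2 * Mf * δ⁻¹) * ‖x - x'‖ ∧
      |ℓ i x a - ℓ i x' a'| ≤ ω ‖x - x'‖ + 2 * Mℓ * Lf * δ⁻¹ * ‖x - x'‖ := by
  have iface_sub : iface e0 ⊆ halfPlane e0 (e i) := by
    rintro y ⟨t, rfl⟩
    exact ⟨t, 0, le_rfl, by simp⟩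
  have hxP := iface_sub hx
  have hxP' := iface_sub hx'
  have hf := hflip i x hxP x' hxP' a ha
  have hl := hlmod i x hxP x' hxP' a ha
  set d := ‖x - x'‖
  have hLd : 0 ≤ Lf * d := (norm_nonneg _).trans hf
  have hMf : 0 ≤ Mf := (norm_nonneg _).trans (hfbdd i x hxP a ha)
  have hMl : 0 ≤ Mℓ := (abs_nonneg _).trans (hlbdd i x hxP a ha)
  rw [show Lf * (1 + 2 * Mf * δ⁻¹) * d = Lf * d + Lf * d * δ⁻¹ * (2 * Mf) by ring,
    show 2 * Mℓ * Lf * δ⁻¹ * d = Lf * d * δ⁻¹ * (2 * Mℓ) by ring]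
  by_cases hs : 0 ≤ ⟪f i x' a, e i⟫
  · exact ⟨a, ha, hs, hf.trans (le_add_of_nonneg_right (by positivity)),
      hl.trans (le_add_of_nonneg_right (by positivity))⟩
  push Not at hs
  obtain ⟨b, hb, hbδ⟩ := htH3 i x' hx' δ ⟨by linarith, le_rfl⟩
  have hs_lower : -⟪f i x' a, e i⟫ ≤ Lf * d := by
    have h := real_inner_le_norm (f i x a - f i x' a) (e i)
    rw [inner_sub_left, he, mul_one] at h
    linarith
  set s : ℝ := ⟪f i x' a, e i⟫
  have hpos : 0 < δ - s := by linarith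
  -- The weight of `b` for which the normal components at `x'` cancel.
  obtain ⟨t, ht⟩ : ∃ t, t = -s / (δ - s) := ⟨_, rfl⟩
  have ht0 : 0 ≤ t := by rw [ht]; exact div_nonneg (by linarith) hpos.le
  have ht1 : t ≤ 1 := by rw [ht, div_le_one hpos]; linarith
  have htδ : t ≤ Lf * d * δ⁻¹ := by
    rw [ht, ← div_eq_mul_inv]
    exact div_le_div₀ hLd hs_lower hδ (by linarith)
  obtain ⟨a', ha', heq⟩ := hH2 i x' hxP' ⟨a, ha, rfl⟩ ⟨b, hb, rfl⟩
    (sub_nonneg.2 ht1) ht0 (sub_add_cancel 1 t)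
  obtain ⟨hfa', hla'⟩ := Prod.ext_iff.1 heq
  simp only [Prod.smul_mk, Prod.mk_add_mk, smul_eq_mul] at hfa' hla'
  refine ⟨a', ha', ?_, ?_, ?_⟩
  · rw [← hfa', inner_add_left, real_inner_smul_left, real_inner_smul_left, hbδ]
    refine le_of_eq ?_
    change 0 = (1 - t) * s + t * δ
    rw [ht]
    field_simp
    ring
  · have hab : ‖f i x' a - f i x' b‖ ≤ 2 * Mf := by
      linarith [norm_sub_le (f i x' a) (f i x' b), hfbdd i x' hxP' a ha, hfbdd i x' hxP' b hb]
    calc ‖f i x a - f i x' a'‖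
        = ‖(f i x a - f i x' a) + t • (f i x' a - f i x' b)‖ := by
          rw [← hfa']; congr 1; module
      _ ≤ ‖f i x a - f i x' a‖ + t * ‖f i x' a - f i x' b‖ := by
          refine (norm_add_le _ _).trans_eq ?_
          rw [norm_smul, Real.norm_of_nonneg ht0]
      _ ≤ Lf * d + Lf * d * δ⁻¹ * (2 * Mf) := by gcongr
  · have hab : |ℓ i x' a - ℓ i x' b| ≤ 2 * Mℓ := by
      linarith [abs_sub (ℓ i x' a) (ℓ i x' b), hlbdd i x' hxP' a ha, hlbdd i x' hxP' b hb]
    calc |ℓ i x a - ℓ i x' a'|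
        = |(ℓ i x a - ℓ i x' a) + t * (ℓ i x' a - ℓ i x' b)| := by
          rw [← hla']; congr 1; ring
      _ ≤ |ℓ i x a - ℓ i x' a| + t * |ℓ i x' a - ℓ i x' b| := by
          refine (abs_add_le _ _).trans_eq ?_
          rw [abs_mul, abs_of_nonneg ht0]
      _ ≤ ω d + Lf * d * δ⁻¹ * (2 * Mℓ) := by gcongr
end
end

section
/- Set M = L_f(1 + 2M_f δ⁻¹), ω(t) = ω_ℓ(t) + 2M_ℓ L_f δ⁻¹ t, and C_M = max(M_f, M_ℓ). Then for every i = 1,…,N the Hamiltonian Hᵢ⁺ satisfies: (i) for all x ∈ Γ and all p₀, pᵢ, qᵢ ∈ ℝ with pᵢ ≤ qᵢ, Hᵢ⁺(x, p₀e₀ + pᵢeᵢ) ≥ Hᵢ⁺(x, p₀e₀ + qᵢeᵢ); (ii) for all x ∈ Γ and p₀, pᵢ ∈ ℝ, Hᵢ⁺(x, p₀e₀ + pᵢeᵢ) ≥ −δpᵢ − C_M(1 + |p₀|); (iii) for all x, y ∈ Γ and all p ∈ ℝe₀ + ℝeᵢ, |Hᵢ⁺(x,p) − Hᵢ⁺(y,p)|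 ≤ M|x−y||p| + ω(|x−y|). -/
open scoped RealInnerProductSpace
open Set Metric MeasureTheory

noncomputable section

/-- If the image of `a ↦ (G a, l a)` is convex and some control points strictly into the half-space
`{w | 0 ≤ ⟪w, v⟫}`, a control which leaves this half-space by at most `η` can be replaced by one
which does not leave it, at a cost proportional to `η`. -/
theorem exists_inward_control {E α : Type*} [NormedAddCommGroup E] [InnerProductSpace ℝ E]
    {s : Set α} {G : α → E} {l : α → ℝ} {v : E} {δ η K L : ℝ}
    (hconv : Convex ℝ {q : E × ℝ | ∃ a ∈ s, q = (G a, l a)})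
    (hG : ∀ a ∈ s, ‖G a‖ ≤ K) (hl : ∀ a ∈ s, |l a| ≤ L) (hδ : 0 < δ)
    {a c : α} (hc : c ∈ s) (hcv : ⟪G c, v⟫ = δ) (ha : a ∈ s) (hη : 0 ≤ η)
    (hav : -η ≤ ⟪G a, v⟫) :
    ∃ b ∈ s, 0 ≤ ⟪G b, v⟫ ∧ ‖G a - G b‖ ≤ 2 * K * δ⁻¹ * η ∧ |l a - l b| ≤ 2 * L * δ⁻¹ * η := by
  have hK : 0 ≤ K := (norm_nonneg _).trans (hG a ha)
  have hL : 0 ≤ L := (abs_nonneg _).trans (hl a ha)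
  rcases le_or_gt 0 ⟪G a, v⟫ with h | h
  · refine ⟨a, ha, h, ?_, ?_⟩
    · rw [sub_self, norm_zero]; positivity
    · rw [sub_self, abs_zero]; positivity
  set ξ := ⟪G a, v⟫ with hξ
  have hd : 0 < δ - ξ := by linarith
  set t := -ξ / (δ - ξ) with ht
  have ht0 : 0 ≤ t := div_nonneg (by linarith) hd.le
  have ht1 : t ≤ 1 := by rw [ht, div_le_one hd]; linarith
  have htη : t ≤ δ⁻¹ * η := by
    rw [ht, ← div_eq_inv_mul]
    exact div_le_div₀ hη (by linarith) hδ (by linarith)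
  obtain ⟨b, hb, hbe⟩ := hconv ⟨a, ha, rfl⟩ ⟨c, hc, rfl⟩ (sub_nonneg.2 ht1) ht0
    (sub_add_cancel 1 t)
  simp only [Prod.smul_mk, Prod.mk_add_mk, Prod.mk.injEq, smul_eq_mul] at hbe
  obtain ⟨hbG, hbl⟩ := hbe
  refine ⟨b, hb, ?_, ?_, ?_⟩
  · rw [← hbG, inner_add_left, real_inner_smul_left, real_inner_smul_left, hcv, ← hξ]
    apply le_of_eq
    rw [ht]
    field_simp
    ring
  · have hdiff : G a - G b = t • (G a - G c) := by rw [← hbG]; module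
    have hac : ‖G a - G c‖ ≤ 2 * K := by
      linarith [norm_sub_le (G a) (G c), hG a ha, hG c hc]
    rw [hdiff, norm_smul, Real.norm_of_nonneg ht0]
    calc t * ‖G a - G c‖ ≤ (δ⁻¹ * η) * (2 * K) := by gcongr
      _ = 2 * K * δ⁻¹ * η := by ring
  · have hdiff : l a - l b = t * (l a - l c) := by rw [← hbl]; ring
    have hac : |l a - l c| ≤ 2 * L := by
      linarith [abs_sub (l a) (l c), hl a ha, hl c hc]
    rw [hdiff, abs_mul, abs_of_nonneg ht0]
    calc t * |l a - l c| ≤ (δ⁻¹ * η) * (2 * L) := by gcongr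
      _ = 2 * L * δ⁻¹ * η := by ring

/-- Monotonicity, one-sided coercivity and regularity in `x` of `Hᵢ⁺` on the
interface. -/
theorem stmt_9
    (N : ℕ) (hN : 2 ≤ N) (e0 : E3) (e : Fin N → E3)
    (he0 : ‖e0‖ = 1) (he : ∀ k, ‖e k‖ = 1)
    (heinj : Function.Injective e) (hee0 : ∀ k, e k ≠ e0)
    (horth : ∀ k, ⟪e k, e0⟫ = 0)
    {A : Type} [MetricSpace A] (Ai : Fin N → Set A)
    (hAne : ∀ k, (Ai k).Nonempty) (hAcp : ∀ k, IsCompact (Ai k))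
    (hAdisj : ∀ k l, k ≠ l → Disjoint (Ai k) (Ai l))
    (f : Fin N → E3 → A → E3) (Mf Lf : ℝ)
    (hfcont : ∀ k, ContinuousOn (fun q : E3 × A => f k q.1 q.2)
      ((halfPlane e0 (e k)) ×ˢ (Ai k)))
    (hfplane : ∀ k, ∀ x ∈ halfPlane e0 (e k), ∀ a ∈ Ai k,
      ∃ c0 ci : ℝ, f k x a = c0 • e0 + ci • e k)
    (hfbdd : ∀ k, ∀ x ∈ halfPlane e0 (e k), ∀ a ∈ Ai k, ‖f k x a‖ ≤ Mf)
    (hflip : ∀ k, ∀ x ∈ halfPlane e0 (e k), ∀ y ∈ halfPlane e0 (e k), ∀ a ∈ Ai k,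
      ‖f k x a - f k y a‖ ≤ Lf * ‖x - y‖)
    (ℓ : Fin N → E3 → A → ℝ) (Mℓ : ℝ) (ω : ℝ → ℝ)
    (hωmono : Monotone ω) (hω0 : ω 0 = 0)
    (hlcont : ∀ k, ContinuousOn (fun q : E3 × A => ℓ k q.1 q.2)
      ((halfPlane e0 (e k)) ×ˢ (Ai k)))
    (hlbdd : ∀ k, ∀ x ∈ halfPlane e0 (e k), ∀ a ∈ Ai k, |ℓ k x a| ≤ Mℓ)
    (hlmod : ∀ k, ∀ x ∈ halfPlane e0 (e k), ∀ y ∈ halfPlane e0 (e k), ∀ a ∈ Ai k,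
      |ℓ k x a - ℓ k y a| ≤ ω ‖x - y‖)
    (hH2 : ∀ k, ∀ x ∈ halfPlane e0 (e k),
      Convex ℝ {q : E3 × ℝ | ∃ a ∈ Ai k, q = (f k x a, ℓ k x a)})
    (δ : ℝ) (hδ : 0 < δ)
    (htH3 : ∀ k, ∀ x ∈ iface e0, ∀ s ∈ Icc (-δ) δ,
      ∃ a ∈ Ai k, ⟪f k x a, e k⟫ = s)
    (Hp : Fin N → E3 → E3 → ℝ)
    (hHp : ∀ k, ∀ x ∈ iface e0, ∀ p : E3,
      IsGreatest {v : ℝ | ∃ a ∈ Ai k, 0 ≤ ⟪f k x a, e k⟫ ∧ v = -⟪p, f k x a⟫ - ℓ k x a}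
        (Hp k x p))
    (i : Fin N) :
    (∀ x ∈ iface e0, ∀ p0 pi qi : ℝ, pi ≤ qi →
      Hp i x (p0 • e0 + qi • e i) ≤ Hp i x (p0 • e0 + pi • e i)) ∧
    (∀ x ∈ iface e0, ∀ p0 pi : ℝ,
      -δ * pi - max Mf Mℓ * (1 + |p0|) ≤ Hp i x (p0 • e0 + pi • e i)) ∧
    (∀ x ∈ iface e0, ∀ y ∈ iface e0, ∀ p : E3, (∃ p0 pi : ℝ, p = p0 • e0 + pi • e i) →
      |Hp i x p - Hp i y p| ≤ Lf * (1 + 2 * Mf * δ⁻¹) * ‖x - y‖ * ‖p‖ +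
        (ω ‖x - y‖ + 2 * Mℓ * Lf * δ⁻¹ * ‖x - y‖)) := by
  have hΓ := iface_subset_halfPlane e0 (e i)
  refine ⟨?_, ?_, ?_⟩
  · intro x hx p0 pi qi hpq
    obtain ⟨a, ha, hae, hav⟩ := (hHp i x hx (p0 • e0 + qi • e i)).1
    refine le_trans ?_ ((hHp i x hx (p0 • e0 + pi • e i)).2 ⟨a, ha, hae, rfl⟩)
    rw [hav]
    simp only [inner_add_left, real_inner_smul_left]
    rw [real_inner_comm] at hae
    linarith [mul_le_mul_of_nonneg_right hpq hae]
  · intro x hx p0 pi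
    obtain ⟨a, ha, hae⟩ := htH3 i x hx δ ⟨by linarith, le_rfl⟩
    refine le_trans ?_ ((hHp i x hx (p0 • e0 + pi • e i)).2 ⟨a, ha, hae ▸ hδ.le, rfl⟩)
    have h0 : |p0 * ⟪e0, f i x a⟫| ≤ |p0| * max Mf Mℓ := by
      rw [abs_mul]
      gcongr
      calc |⟪e0, f i x a⟫| ≤ ‖e0‖ * ‖f i x a‖ := abs_real_inner_le_norm _ _
        _ ≤ max Mf Mℓ := by
          rw [he0, one_mul]
          exact (hfbdd i x (hΓ hx) a ha).trans (le_max_left _ _)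
    have h1 : |ℓ i x a| ≤ max Mf Mℓ := (hlbdd i x (hΓ hx) a ha).trans (le_max_right _ _)
    rw [real_inner_comm] at hae
    rw [inner_add_left, real_inner_smul_left, real_inner_smul_left, hae]
    linarith [le_abs_self (p0 * ⟪e0, f i x a⟫), le_abs_self (ℓ i x a)]
  · have hone : ∀ x ∈ iface e0, ∀ y ∈ iface e0, ∀ p : E3,
        Hp i x p - Hp i y p ≤ Lf * (1 + 2 * Mf * δ⁻¹) * ‖x - y‖ * ‖p‖ +
          (ω ‖x - y‖ + 2 * Mℓ * Lf * δ⁻¹ * ‖x - y‖) := by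
      intro x hx y hy p
      obtain ⟨a, ha, hae, hav⟩ := (hHp i x hx p).1
      obtain ⟨c, hc, hce⟩ := htH3 i y hy δ ⟨by linarith, le_rfl⟩
      have hLip := hflip i x (hΓ hx) y (hΓ hy) a ha
      have hout : -(Lf * ‖x - y‖) ≤ ⟪f i y a, e i⟫ := by
        have h := real_inner_le_norm (f i x a - f i y a) (e i)
        rw [inner_sub_left, he i, mul_one] at h
        linarith
      obtain ⟨b, hb, hbe, hfb, hlb⟩ := exists_inward_control (hH2 i y (hΓ hy))
        (hfbdd i y (hΓ hy)) (hlbdd i y (hΓ hy)) hδ hc hce ha ((norm_nonneg _).trans hLip) hout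
      have hy_ge := (hHp i y hy p).2 ⟨b, hb, hbe, rfl⟩
      have hf : ‖f i y b - f i x a‖ ≤ Lf * (1 + 2 * Mf * δ⁻¹) * ‖x - y‖ := by
        rw [norm_sub_rev]
        linarith [norm_sub_le_norm_sub_add_norm_sub (f i x a) (f i y a) (f i y b)]
      have hp := (real_inner_le_norm p (f i y b - f i x a)).trans
        (mul_le_mul_of_nonneg_left hf (norm_nonneg p))
      rw [inner_sub_right] at hp
      have hl := hlmod i x (hΓ hx) y (hΓ hy) a ha
      rw [abs_le] at hl hlb
      rw [hav]
      linarith [hl.1, hlb.1]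
    intro x hx y hy p _
    refine abs_le.2 ⟨?_, hone x hx y hy p⟩
    have h := hone y hy x hx p
    rw [norm_sub_rev y x] at h
    linarith
end
end

section
/- For every x ∈ Γ, every i ∈ {1,…,N}, every a ∈ Aᵢ with fᵢ(x,a)·eᵢ ≥ 0, and every ε ∈ (0,1], there exists a_ε ∈ Aᵢ such that fᵢ(x,a_ε)·eᵢ ≥ δε > 0, |fᵢ(x,a_ε) − fᵢ(x,a)| ≤ 2M_f ε, and |ℓᵢ(x,a_ε) − ℓᵢ(x,a)| ≤ 2M_ℓ ε. -/
open scoped RealInnerProductSpace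
open Set Metric MeasureTheory

noncomputable section

/-- Approximation of an inward control on `Γ` by strictly inward controls. -/
theorem stmt_10
    (N : ℕ) (hN : 2 ≤ N) (e0 : E3) (e : Fin N → E3)
    (he0 : ‖e0‖ = 1) (he : ∀ k, ‖e k‖ = 1)
    (heinj : Function.Injective e) (hee0 : ∀ k, e k ≠ e0)
    (horth : ∀ k, ⟪e k, e0⟫ = 0)
    {A : Type} [MetricSpace A] (Ai : Fin N → Set A)
    (hAne : ∀ k, (Ai k).Nonempty) (hAcp : ∀ k, IsCompact (Ai k))
    (hAdisj : ∀ k l, k ≠ l → Disjoint (Ai k) (Ai l))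
    (f : Fin N → E3 → A → E3) (Mf Lf : ℝ)
    (hfcont : ∀ k, ContinuousOn (fun q : E3 × A => f k q.1 q.2)
      ((halfPlane e0 (e k)) ×ˢ (Ai k)))
    (hfplane : ∀ k, ∀ x ∈ halfPlane e0 (e k), ∀ a ∈ Ai k,
      ∃ c0 ci : ℝ, f k x a = c0 • e0 + ci • e k)
    (hfbdd : ∀ k, ∀ x ∈ halfPlane e0 (e k), ∀ a ∈ Ai k, ‖f k x a‖ ≤ Mf)
    (hflip : ∀ k, ∀ x ∈ halfPlane e0 (e k), ∀ y ∈ halfPlane e0 (e k), ∀ a ∈ Ai k,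
      ‖f k x a - f k y a‖ ≤ Lf * ‖x - y‖)
    (ℓ : Fin N → E3 → A → ℝ) (Mℓ : ℝ) (ω : ℝ → ℝ)
    (hωmono : Monotone ω) (hω0 : ω 0 = 0)
    (hlcont : ∀ k, ContinuousOn (fun q : E3 × A => ℓ k q.1 q.2)
      ((halfPlane e0 (e k)) ×ˢ (Ai k)))
    (hlbdd : ∀ k, ∀ x ∈ halfPlane e0 (e k), ∀ a ∈ Ai k, |ℓ k x a| ≤ Mℓ)
    (hlmod : ∀ k, ∀ x ∈ halfPlane e0 (e k), ∀ y ∈ halfPlane e0 (e k), ∀ a ∈ Ai k,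
      |ℓ k x a - ℓ k y a| ≤ ω ‖x - y‖)
    (hH2 : ∀ k, ∀ x ∈ halfPlane e0 (e k),
      Convex ℝ {q : E3 × ℝ | ∃ a ∈ Ai k, q = (f k x a, ℓ k x a)})
    (δ : ℝ) (hδ : 0 < δ)
    (htH3 : ∀ k, ∀ x ∈ iface e0, ∀ s ∈ Icc (-δ) δ,
      ∃ a ∈ Ai k, ⟪f k x a, e k⟫ = s)
    (x : E3) (hx : x ∈ iface e0) (i : Fin N) (a : A) (ha : a ∈ Ai i)
    (hin : 0 ≤ ⟪f i x a, e i⟫) (ε : ℝ) (hε : ε ∈ Ioc (0 : ℝ) 1) :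
    ∃ aε ∈ Ai i, δ * ε ≤ ⟪f i x aε, e i⟫ ∧ 0 < δ * ε ∧
      ‖f i x aε - f i x a‖ ≤ 2 * Mf * ε ∧
      |ℓ i x aε - ℓ i x a| ≤ 2 * Mℓ * ε := by
  obtain ⟨hε0, hε1⟩ := hε
  have hxP : x ∈ halfPlane e0 (e i) := by
    obtain ⟨t, rfl⟩ := hx
    exact ⟨t, 0, le_rfl, by simp⟩
  obtain ⟨b, hb, hbδ⟩ := htH3 i x hx δ ⟨by linarith, le_rfl⟩
  obtain ⟨c, hc, hfl⟩ := hH2 i x hxP ⟨a, ha, rfl⟩ ⟨b, hb, rfl⟩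
    (sub_nonneg.2 hε1) hε0.le (sub_add_cancel 1 ε)
  simp only [Prod.smul_mk, Prod.mk_add_mk, Prod.mk.injEq, smul_eq_mul] at hfl
  obtain ⟨hf, hl⟩ := hfl
  refine ⟨c, hc, ?_, mul_pos hδ hε0, ?_, ?_⟩
  · rw [← hf, inner_add_left, real_inner_smul_left, real_inner_smul_left, hbδ]
    nlinarith [mul_nonneg (sub_nonneg.2 hε1) hin]
  · have h : f i x c - f i x a = ε • (f i x b - f i x a) := by
      rw [← hf]
      module
    rw [h, norm_smul, Real.norm_of_nonneg hε0.le, mul_comm]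
    gcongr
    linarith [norm_sub_le (f i x b) (f i x a), hfbdd i x hxP a ha, hfbdd i x hxP b hb]
  · have h : ℓ i x c - ℓ i x a = ε * (ℓ i x b - ℓ i x a) := by
      rw [← hl]
      ring
    rw [h, abs_mul, abs_of_pos hε0, mul_comm]
    gcongr
    linarith [abs_sub (ℓ i x b) (ℓ i x a), hlbdd i x hxP a ha, hlbdd i x hxP b hb]
end
end

section
/- For every i ∈ {1,…,N}, every x ∈ Γ and every p ∈ ℝe₀ + ℝeᵢ, max_{a∈Aᵢ : fᵢ(x,a)·eᵢ ≥ 0}(−p·fᵢ(x,a) − ℓᵢ(x,a)) = sup_{a∈Aᵢ : fᵢ(x,a)·eᵢ > 0}(−p·fᵢ(x,a) − ℓᵢ(x,a)). -/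
open scoped RealInnerProductSpace
open Set Metric MeasureTheory

noncomputable section

/-- Maximizing a linear functional `φ` over a convex set subject to `0 ≤ ψ` gives the same value
as taking the supremum subject to `0 < ψ`, provided the strict constraint is feasible. -/
theorem isLUB_image_pos_of_isGreatest_image_nonneg {E : Type*} [AddCommGroup E] [Module ℝ E]
    {C : Set E} (hC : Convex ℝ C) (φ ψ : E →ₗ[ℝ] ℝ) {M : ℝ}
    (hM : IsGreatest (φ '' {q ∈ C | 0 ≤ ψ q}) M) {b : E} (hb : b ∈ C) (hψb : 0 < ψ b) :
    IsLUB (φ '' {q ∈ C | 0 < ψ q}) M := by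
  obtain ⟨⟨a, ⟨ha, hψa⟩, hφa⟩, hub⟩ := hM
  refine ⟨?_, fun w hw => ?_⟩
  · rintro _ ⟨q, ⟨hq, hψq⟩, rfl⟩
    exact hub ⟨q, ⟨hq, hψq.le⟩, rfl⟩
  · by_contra! hlt
    have hbM : φ b ≤ M := hub ⟨b, ⟨hb, hψb.le⟩, rfl⟩
    have hpos : 0 < (M - w) + (M - φ b) := by linarith
    set t : ℝ := (M - w) / ((M - w) + (M - φ b)) with ht
    have ht0 : 0 < t := div_pos (by linarith) hpos
    have ht1 : t ≤ 1 := (div_le_one hpos).2 (by linarith)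
    have hmul : t * ((M - w) + (M - φ b)) = M - w := div_mul_cancel₀ _ hpos.ne'
    have hmem : (1 - t) • a + t • b ∈ C := hC ha hb (by linarith) ht0.le (by ring)
    have hψ : 0 < ψ ((1 - t) • a + t • b) := by
      simp only [map_add, map_smul, smul_eq_mul]
      exact add_pos_of_nonneg_of_pos (mul_nonneg (by linarith) hψa) (mul_pos ht0 hψb)
    have hle := hw ⟨_, ⟨hmem, hψ⟩, rfl⟩
    simp only [map_add, map_smul, smul_eq_mul, hφa] at hle
    nlinarith [mul_pos ht0 (sub_pos.2 hlt)]

/-- The max over controls with `fᵢ·eᵢ ≥ 0` equals the sup over controls with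
`fᵢ·eᵢ > 0`. -/
theorem stmt_11
    (N : ℕ) (hN : 2 ≤ N) (e0 : E3) (e : Fin N → E3)
    (he0 : ‖e0‖ = 1) (he : ∀ k, ‖e k‖ = 1)
    (heinj : Function.Injective e) (hee0 : ∀ k, e k ≠ e0)
    (horth : ∀ k, ⟪e k, e0⟫ = 0)
    {A : Type} [MetricSpace A] (Ai : Fin N → Set A)
    (hAne : ∀ k, (Ai k).Nonempty) (hAcp : ∀ k, IsCompact (Ai k))
    (hAdisj : ∀ k l, k ≠ l → Disjoint (Ai k) (Ai l))
    (f : Fin N → E3 → A → E3) (Mf Lf : ℝ)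
    (hfcont : ∀ k, ContinuousOn (fun q : E3 × A => f k q.1 q.2)
      ((halfPlane e0 (e k)) ×ˢ (Ai k)))
    (hfplane : ∀ k, ∀ x ∈ halfPlane e0 (e k), ∀ a ∈ Ai k,
      ∃ c0 ci : ℝ, f k x a = c0 • e0 + ci • e k)
    (hfbdd : ∀ k, ∀ x ∈ halfPlane e0 (e k), ∀ a ∈ Ai k, ‖f k x a‖ ≤ Mf)
    (hflip : ∀ k, ∀ x ∈ halfPlane e0 (e k), ∀ y ∈ halfPlane e0 (e k), ∀ a ∈ Ai k,
      ‖f k x a - f k y a‖ ≤ Lf * ‖x - y‖)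
    (ℓ : Fin N → E3 → A → ℝ) (Mℓ : ℝ) (ω : ℝ → ℝ)
    (hωmono : Monotone ω) (hω0 : ω 0 = 0)
    (hlcont : ∀ k, ContinuousOn (fun q : E3 × A => ℓ k q.1 q.2)
      ((halfPlane e0 (e k)) ×ˢ (Ai k)))
    (hlbdd : ∀ k, ∀ x ∈ halfPlane e0 (e k), ∀ a ∈ Ai k, |ℓ k x a| ≤ Mℓ)
    (hlmod : ∀ k, ∀ x ∈ halfPlane e0 (e k), ∀ y ∈ halfPlane e0 (e k), ∀ a ∈ Ai k,
      |ℓ k x a - ℓ k y a| ≤ ω ‖x - y‖)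
    (hH2 : ∀ k, ∀ x ∈ halfPlane e0 (e k),
      Convex ℝ {q : E3 × ℝ | ∃ a ∈ Ai k, q = (f k x a, ℓ k x a)})
    (δ : ℝ) (hδ : 0 < δ)
    (htH3 : ∀ k, ∀ x ∈ iface e0, ∀ s ∈ Icc (-δ) δ,
      ∃ a ∈ Ai k, ⟪f k x a, e k⟫ = s)
    (Hp : Fin N → E3 → E3 → ℝ)
    (hHp : ∀ k, ∀ x ∈ iface e0, ∀ p : E3,
      IsGreatest {v : ℝ | ∃ a ∈ Ai k, 0 ≤ ⟪f k x a, e k⟫ ∧ v = -⟪p, f k x a⟫ - ℓ k x a}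
        (Hp k x p))
    (i : Fin N) (x : E3) (hx : x ∈ iface e0) (p : E3)
    (hp : ∃ p0 pi : ℝ, p = p0 • e0 + pi • e i) :
    Hp i x p =
      sSup {v : ℝ | ∃ a ∈ Ai i, 0 < ⟪f i x a, e i⟫ ∧ v = -⟪p, f i x a⟫ - ℓ i x a} := by
  have hxP : x ∈ halfPlane e0 (e i) := by
    obtain ⟨t, rfl⟩ := hx
    exact ⟨t, 0, le_rfl, by simp⟩
  obtain ⟨b, hb, hbδ⟩ := htH3 i x hx δ ⟨by linarith, le_rfl⟩
  let φ : E3 × ℝ →ₗ[ℝ] ℝ := -(innerₗ E3 p ∘ₗ LinearMap.fst ℝ E3 ℝ) - LinearMap.snd ℝ E3 ℝ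
  let ψ : E3 × ℝ →ₗ[ℝ] ℝ := innerₗ E3 (e i) ∘ₗ LinearMap.fst ℝ E3 ℝ
  have hφ (q : E3 × ℝ) : φ q = -⟪p, q.1⟫ - q.2 := rfl
  have hψ (q : E3 × ℝ) : ψ q = ⟪q.1, e i⟫ := real_inner_comm (F := E3) _ _
  have himage (P : ℝ → Prop) :
      φ '' {q ∈ {q : E3 × ℝ | ∃ a ∈ Ai i, q = (f i x a, ℓ i x a)} | P (ψ q)} =
        {v : ℝ | ∃ a ∈ Ai i, P ⟪f i x a, e i⟫ ∧ v = -⟪p, f i x a⟫ - ℓ i x a} := by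
    ext v
    constructor
    · rintro ⟨_, ⟨⟨a, ha, rfl⟩, hP⟩, rfl⟩
      rw [hψ] at hP
      exact ⟨a, ha, hP, hφ _⟩
    · rintro ⟨a, ha, hP, rfl⟩
      refine ⟨(f i x a, ℓ i x a), ⟨⟨a, ha, rfl⟩, ?_⟩, hφ _⟩
      rwa [hψ]
  have hmax := hHp i x hx p
  rw [← himage (0 ≤ ·)] at hmax
  have hψb : 0 < ψ (f i x b, ℓ i x b) := by rwa [hψ, hbδ]
  have hlub := isLUB_image_pos_of_isGreatest_image_nonneg (hH2 i x hxP) φ ψ hmax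
    ⟨b, hb, rfl⟩ hψb
  rw [himage (0 < ·)] at hlub
  exact (hlub.csSup_eq ⟨_, b, hb, hbδ ▸ hδ, rfl⟩).symm
end
end

section
/- There exists T > 0 such that for every i ∈ {1,…,N} and every x ∈ Pᵢ there is a Lipschitz continuous function y : [0,T] → Pᵢ with y(0) = x and y'(t) ∈ Fᵢ(y(t)) for almost every t ∈ (0,T); in particular the differential inclusion ẏ(t) ∈ F̃(y(t)), y(0) = x (where F̃(z) = Fᵢ(z) if z ∈ Pᵢ∖Γ and F̃(z) = ∪_{j=1}^N Fⱼ(z) if z ∈ Γ) has a solution staying in Pᵢ on [0,T]. -/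
open scoped RealInnerProductSpace
open Set Metric MeasureTheory

noncomputable section

/-- A bounded Lipschitz vector field has integral curves on every interval `[0, T]`. -/
theorem exists_integralCurve_Icc {E : Type*} [NormedAddCommGroup E] [NormedSpace ℝ E]
    [CompleteSpace E] {g : E → E} {K M : NNReal} (hg : LipschitzWith K g)
    (hM : ∀ z, ‖g z‖ ≤ M) {T : ℝ} (hT : 0 ≤ T) (x : E) :
    ∃ y : ℝ → E, y 0 = x ∧ ∀ t ∈ Icc 0 T, HasDerivWithinAt y (g (y t)) (Icc 0 T) t := by
  have h : IsPicardLindelof (fun _ ↦ g) (⟨0, le_rfl, hT⟩ : Icc (0 : ℝ) T) x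
      (M * T.toNNReal) 0 M K := by
    refine IsPicardLindelof.of_time_independent (fun z _ ↦ hM z) hg.lipschitzOnWith ?_
    simp [hT]
  exact h.exists_eq_forall_mem_Icc_hasDerivWithinAt₀

/-- The nearest-point retraction onto the half-plane spanned by the orthonormal pair `e0`, `ei`. -/
def halfPlaneProj (e0 ei z : E3) : E3 := ⟪z, e0⟫ • e0 + max ⟪z, ei⟫ 0 • ei

theorem halfPlaneProj_mem (e0 ei z : E3) : halfPlaneProj e0 ei z ∈ halfPlane e0 ei :=
  ⟨_, _, le_max_right _ _, rfl⟩

theorem inner_smul_add_smul_left {e0 ei : E3} (h0 : ‖e0‖ = 1) (h : ⟪ei, e0⟫ = 0) (a b : ℝ) :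
    ⟪a • e0 + b • ei, e0⟫ = a := by
  simp [inner_add_left, inner_smul_left, h, h0]

theorem inner_smul_add_smul_right {e0 ei : E3} (hi : ‖ei‖ = 1) (h : ⟪ei, e0⟫ = 0) (a b : ℝ) :
    ⟪a • e0 + b • ei, ei⟫ = b := by
  rw [real_inner_comm] at h
  simp [inner_add_left, inner_smul_left, h, hi]

theorem halfPlaneProj_eq_self {e0 ei : E3} (h0 : ‖e0‖ = 1) (hi : ‖ei‖ = 1) (h : ⟪ei, e0⟫ = 0)
    {z : E3} (hz : z ∈ halfPlane e0 ei) : halfPlaneProj e0 ei z = z := by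
  obtain ⟨a, b, hb, rfl⟩ := hz
  rw [halfPlaneProj, inner_smul_add_smul_left h0 h, inner_smul_add_smul_right hi h,
    max_eq_left hb]

theorem norm_halfPlaneProj_sub_le {e0 ei : E3} (h0 : ‖e0‖ = 1) (hi : ‖ei‖ = 1) (z w : E3) :
    ‖halfPlaneProj e0 ei z - halfPlaneProj e0 ei w‖ ≤ 2 * ‖z - w‖ := by
  have key : halfPlaneProj e0 ei z - halfPlaneProj e0 ei w =
      ⟪z - w, e0⟫ • e0 + (max ⟪z, ei⟫ 0 - max ⟪w, ei⟫ 0) • ei := by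
    rw [halfPlaneProj, halfPlaneProj, inner_sub_left]
    module
  have b0 : |⟪z - w, e0⟫| ≤ ‖z - w‖ := by
    simpa [h0] using abs_real_inner_le_norm (z - w) e0
  have bi : |max ⟪z, ei⟫ 0 - max ⟪w, ei⟫ 0| ≤ ‖z - w‖ := by
    refine (abs_max_sub_max_le_abs _ _ _).trans ?_
    rw [← inner_sub_left]
    simpa [hi] using abs_real_inner_le_norm (z - w) ei
  rw [key]
  refine (norm_add_le _ _).trans ?_
  rw [norm_smul, norm_smul, h0, hi, Real.norm_eq_abs, Real.norm_eq_abs]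
  linarith

/-- A curve starting in the half-plane whose velocity is tangent to the plane spanned by `e0`
and `ei` stays in the half-plane as long as its normal coordinate is nonnegative. -/
theorem mem_halfPlane_of_hasDerivWithinAt {e0 ei : E3} (h0 : ‖e0‖ = 1) (hi : ‖ei‖ = 1)
    (h : ⟪ei, e0⟫ = 0) {T : ℝ} {y y' : ℝ → E3}
    (hy : ∀ t ∈ Icc 0 T, HasDerivWithinAt y (y' t) (Icc 0 T) t)
    (hplane : ∀ t ∈ Icc 0 T, ∃ c0 ci : ℝ, y' t = c0 • e0 + ci • ei)
    (hy0 : y 0 ∈ halfPlane e0 ei) (hpos : ∀ t ∈ Icc 0 T, 0 ≤ ⟪y t, ei⟫) :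
    ∀ t ∈ Icc 0 T, y t ∈ halfPlane e0 ei := by
  intro t ht
  have hd : ∀ s ∈ Icc 0 T, HasDerivWithinAt
      (fun s ↦ y s - (⟪y s, e0⟫ • e0 + ⟪y s, ei⟫ • ei)) 0 (Icc 0 T) s := by
    intro s hs
    have d0 := ((hy s hs).inner ℝ (hasDerivWithinAt_const s (Icc 0 T) e0)).smul_const e0
    have di := ((hy s hs).inner ℝ (hasDerivWithinAt_const s (Icc 0 T) ei)).smul_const ei
    obtain ⟨a, b, hab⟩ := hplane s hs
    have hz : y' s - ((⟪y s, 0⟫ + ⟪y' s, e0⟫) • e0 + (⟪y s, 0⟫ + ⟪y' s, ei⟫) • ei) = 0 := by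
      rw [hab, inner_smul_add_smul_left h0 h, inner_smul_add_smul_right hi h]
      simp
    exact hz ▸ (hy s hs).sub (d0.add di)
  have hc := norm_image_sub_le_of_norm_deriv_le_segment' (C := 0) hd (by simp) t ht
  rw [zero_mul, norm_le_zero_iff, sub_eq_zero] at hc
  obtain ⟨a, b, -, hab⟩ := hy0
  rw [hab, inner_smul_add_smul_left h0 h, inner_smul_add_smul_right hi h, sub_self,
    sub_eq_zero] at hc
  exact ⟨_, _, hpos t ht, hc⟩

/-- A Lipschitz field on the half-plane, tangent to it and bounded by `M`, has an integral curve
from `x` staying in the half-plane on `[0, T]`, provided `x` is at distance at least `M * T` from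
the interface or the field points inwards within distance `2 * M * T` of `x`. -/
theorem exists_integralCurve_mem_halfPlane {e0 ei : E3} (h0 : ‖e0‖ = 1) (hi : ‖ei‖ = 1)
    (h : ⟪ei, e0⟫ = 0) {g : E3 → E3} {K M : NNReal}
    (hg : LipschitzOnWith K g (halfPlane e0 ei)) (hM : ∀ z ∈ halfPlane e0 ei, ‖g z‖ ≤ M)
    (hplane : ∀ z ∈ halfPlane e0 ei, ∃ c0 ci : ℝ, g z = c0 • e0 + ci • ei)
    {T : ℝ} (hT : 0 ≤ T) {x : E3} (hx : x ∈ halfPlane e0 ei)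
    (hin : M * T ≤ ⟪x, ei⟫ ∨
      ∀ z ∈ halfPlane e0 ei, ‖z - x‖ ≤ 2 * (M * T) → 0 ≤ ⟪g z, ei⟫) :
    ∃ y : ℝ → E3, LipschitzOnWith M y (Icc 0 T) ∧ y 0 = x ∧
      (∀ t ∈ Icc 0 T, y t ∈ halfPlane e0 ei) ∧
      ∀ t ∈ Ioo 0 T, HasDerivAt y (g (y t)) t := by
  have hmem := halfPlaneProj_mem e0 ei
  have hP : LipschitzWith 2 (halfPlaneProj e0 ei) :=
    LipschitzWith.of_dist_le_mul fun z w ↦ by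
      simpa [dist_eq_norm] using norm_halfPlaneProj_sub_le h0 hi z w
  have hgP : LipschitzWith (K * 2) (g ∘ halfPlaneProj e0 ei) :=
    lipschitzOnWith_univ.1 (hg.comp hP.lipschitzOnWith fun z _ ↦ hmem z)
  obtain ⟨y, hy0, hy⟩ := exists_integralCurve_Icc hgP (fun z ↦ hM _ (hmem z)) hT x
  have hdist : ∀ t ∈ Icc 0 T, ‖y t - x‖ ≤ M * T := by
    intro t ht
    have := norm_image_sub_le_of_norm_deriv_le_segment' hy (fun t _ ↦ hM _ (hmem (y t))) t ht
    rw [hy0, sub_zero] at this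
    exact this.trans (mul_le_mul_of_nonneg_left ht.2 M.2)
  have hxpos : 0 ≤ ⟪x, ei⟫ := by
    obtain ⟨a, b, hb, rfl⟩ := hx
    rwa [inner_smul_add_smul_right hi h]
  have hpos : ∀ t ∈ Icc 0 T, 0 ≤ ⟪y t, ei⟫ := by
    intro t ht
    rcases hin with hfar | hnear
    · have h1 := (abs_real_inner_le_norm (y t - x) ei).trans_eq (by rw [hi, mul_one])
      rw [inner_sub_left] at h1
      linarith [(abs_le.1 h1).1, hdist t ht]
    · have hd : ∀ s ∈ Icc 0 T, HasDerivWithinAt (fun s ↦ ⟪y s, ei⟫)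
          ⟪g (halfPlaneProj e0 ei (y s)), ei⟫ (Icc 0 T) s := fun s hs ↦ by
        simpa using (hy s hs).inner ℝ (hasDerivWithinAt_const s (Icc 0 T) ei)
      have hmono : MonotoneOn (fun s ↦ ⟪y s, ei⟫) (Icc 0 T) := by
        refine monotoneOn_of_hasDerivWithinAt_nonneg (convex_Icc 0 T)
          (fun s hs ↦ (hd s hs).continuousWithinAt)
          (fun s hs ↦ (hd s (interior_subset hs)).mono interior_subset) fun s hs ↦ ?_
        refine hnear _ (hmem _) ?_
        have := norm_halfPlaneProj_sub_le h0 hi (y s) x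
        rw [halfPlaneProj_eq_self h0 hi h hx] at this
        linarith [hdist s (interior_subset hs)]
      have := hmono ⟨le_rfl, hT⟩ ht ht.1
      simp only [hy0] at this
      exact hxpos.trans this
  have hstay := mem_halfPlane_of_hasDerivWithinAt h0 hi h hy
    (fun t _ ↦ hplane _ (hmem (y t))) (hy0 ▸ hx) hpos
  refine ⟨y, ?_, hy0, hstay, fun t ht ↦ ?_⟩
  · exact (convex_Icc 0 T).lipschitzOnWith_of_nnnorm_hasDerivWithin_le hy
      fun t _ ↦ hM _ (hmem (y t))
  · have := (hy t (Ioo_subset_Icc_self ht)).hasDerivAt (Icc_mem_nhds ht.1 ht.2)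
    rwa [Function.comp_apply, halfPlaneProj_eq_self h0 hi h
      (hstay t (Ioo_subset_Icc_self ht))] at this

/-- Under normal controllability, from any point of `Pᵢ` there is an admissible
trajectory staying in `Pᵢ` on a uniform time interval `[0,T]`. -/
theorem stmt_14
    (N : ℕ) (hN : 2 ≤ N) (e0 : E3) (e : Fin N → E3)
    (he0 : ‖e0‖ = 1) (he : ∀ k, ‖e k‖ = 1)
    (heinj : Function.Injective e) (hee0 : ∀ k, e k ≠ e0)
    (horth : ∀ k, ⟪e k, e0⟫ = 0)
    {A : Type} [MetricSpace A] (Ai : Fin N → Set A)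
    (hAne : ∀ k, (Ai k).Nonempty) (hAcp : ∀ k, IsCompact (Ai k))
    (hAdisj : ∀ k l, k ≠ l → Disjoint (Ai k) (Ai l))
    (f : Fin N → E3 → A → E3) (Mf Lf : ℝ)
    (hfcont : ∀ k, ContinuousOn (fun q : E3 × A => f k q.1 q.2)
      ((halfPlane e0 (e k)) ×ˢ (Ai k)))
    (hfplane : ∀ k, ∀ x ∈ halfPlane e0 (e k), ∀ a ∈ Ai k,
      ∃ c0 ci : ℝ, f k x a = c0 • e0 + ci • e k)
    (hfbdd : ∀ k, ∀ x ∈ halfPlane e0 (e k), ∀ a ∈ Ai k, ‖f k x a‖ ≤ Mf)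
    (hflip : ∀ k, ∀ x ∈ halfPlane e0 (e k), ∀ y ∈ halfPlane e0 (e k), ∀ a ∈ Ai k,
      ‖f k x a - f k y a‖ ≤ Lf * ‖x - y‖)
    (ℓ : Fin N → E3 → A → ℝ)
    (hH2 : ∀ k, ∀ x ∈ halfPlane e0 (e k),
      Convex ℝ {q : E3 × ℝ | ∃ a ∈ Ai k, q = (f k x a, ℓ k x a)})
    (δ : ℝ) (hδ : 0 < δ)
    (htH3 : ∀ k, ∀ x ∈ iface e0, ∀ s ∈ Icc (-δ) δ,
      ∃ a ∈ Ai k, ⟪f k x a, e k⟫ = s)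
 :
    ∃ T : ℝ, 0 < T ∧ ∀ i : Fin N, ∀ x ∈ halfPlane e0 (e i),
      ∃ y : ℝ → E3, ∃ L : NNReal,
        LipschitzOnWith L y (Icc 0 T) ∧ y 0 = x ∧
        (∀ t ∈ Icc (0 : ℝ) T, y t ∈ halfPlane e0 (e i)) ∧
        (∀ᵐ t ∂(volume.restrict (Ioo (0 : ℝ) T)),
          ∃ a ∈ Ai i, HasDerivAt y (f i (y t) a) t) := by
  set L : ℝ := max Lf 1
  set M : ℝ := max Mf 1
  have hLpos : 0 < L := lt_of_lt_of_le one_pos (le_max_right _ _)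
  have hMpos : 0 < M := lt_of_lt_of_le one_pos (le_max_right _ _)
  set ρ : ℝ := δ / (3 * L) with hρ
  have hρpos : 0 < ρ := by positivity
  have hρL : L * (3 * ρ) = δ := by rw [hρ]; field_simp
  have hMT : M * (ρ / M) = ρ := by field_simp
  have hlip : ∀ k, ∀ x ∈ halfPlane e0 (e k), ∀ y ∈ halfPlane e0 (e k), ∀ a ∈ Ai k,
      ‖f k x a - f k y a‖ ≤ L * ‖x - y‖ := fun k x hx y hy a ha ↦
    (hflip k x hx y hy a ha).trans
      (mul_le_mul_of_nonneg_right (le_max_left _ _) (norm_nonneg _))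
  refine ⟨ρ / M, by positivity, fun i x hx ↦ ?_⟩
  obtain ⟨a, ha, hin⟩ : ∃ a ∈ Ai i, ρ ≤ ⟪x, e i⟫ ∨
      ∀ z ∈ halfPlane e0 (e i), ‖z - x‖ ≤ 2 * ρ → 0 ≤ ⟪f i z a, e i⟫ := by
    rcases le_or_gt ρ ⟪x, e i⟫ with hfar | hnear
    · obtain ⟨a, ha⟩ := hAne i
      exact ⟨a, ha, Or.inl hfar⟩
    obtain ⟨c, b, hb, rfl⟩ := hx
    rw [inner_smul_add_smul_right (he i) (horth i)] at hnear
    obtain ⟨a, ha, hδa⟩ := htH3 i (c • e0) ⟨c, rfl⟩ δ ⟨by linarith, le_rfl⟩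
    refine ⟨a, ha, Or.inr fun z hz hzx ↦ ?_⟩
    have hzc : ‖z - c • e0‖ ≤ 3 * ρ := by
      have hsplit : z - c • e0 = (z - (c • e0 + b • e i)) + b • e i := by module
      have hbn : ‖b • e i‖ = b := by rw [norm_smul, he, mul_one, Real.norm_of_nonneg hb]
      rw [hsplit]
      linarith [norm_add_le (z - (c • e0 + b • e i)) (b • e i)]
    have h1 := (abs_real_inner_le_norm (f i z a - f i (c • e0) a) (e i)).trans_eq
      (by rw [he, mul_one])
    have h2 := hlip i z hz (c • e0) ⟨c, 0, le_rfl, by simp⟩ a ha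
    have h3 := mul_le_mul_of_nonneg_left hzc hLpos.le
    rw [inner_sub_left, hδa] at h1
    linarith [(abs_le.1 h1).1]
  obtain ⟨y, hyL, hy0, hyP, hyd⟩ := exists_integralCurve_mem_halfPlane he0 (he i) (horth i)
    (g := fun z ↦ f i z a) (K := L.toNNReal) (M := M.toNNReal) (T := ρ / M) (x := x)
    (LipschitzOnWith.of_dist_le_mul fun z hz w hw ↦ by
      rw [dist_eq_norm, dist_eq_norm, Real.coe_toNNReal L hLpos.le]
      exact hlip i z hz w hw a ha)
    (fun z hz ↦ (hfbdd i z hz a ha).trans ((le_max_left _ _).trans (Real.le_coe_toNNReal M)))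
    (fun z hz ↦ hfplane i z hz a ha) (by positivity) hx
    (by rwa [Real.coe_toNNReal M hMpos.le, hMT])
  refine ⟨y, _, hyL, hy0, hyP, ?_⟩
  filter_upwards [ae_restrict_mem measurableSet_Ioo] with t ht
  exact ⟨a, ha, hyd t ht⟩
end
end

section
/- There exist constants r > 0 and C > 0 such that for every i ∈ {1,…,N} and every x = x₀e₀ + xᵢeᵢ ∈ B(Γ,r) ∩ (Pᵢ∖Γ) there exist a time τ ∈ (0, C·xᵢ] and a Lipschitz continuous function y : [0,τ] → Pᵢ with y(0) = x, y'(t) ∈ Fᵢ(y(t)) for almost every t ∈ (0,τ), and y(τ) ∈ Γ; that is, from any point at distance xᵢ from the interface inside Pᵢ, an admissible trajectory reaches Γ in time at most C·xᵢ. -/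
open scoped RealInnerProductSpace
open Set Metric MeasureTheory

noncomputable section

/-- A bounded, globally Lipschitz autonomous vector field has an integral curve on every
interval `[0, T]`. -/
theorem exists_hasDerivWithinAt_Icc_of_lipschitzWith {E : Type*} [NormedAddCommGroup E]
    [NormedSpace ℝ E] [CompleteSpace E] {G : E → E} {K M : NNReal} (hG : LipschitzWith K G)
    (hM : ∀ x, ‖G x‖ ≤ M) {T : ℝ} (hT : 0 ≤ T) (x : E) :
    ∃ u : ℝ → E, u 0 = x ∧ ∀ t ∈ Icc 0 T, HasDerivWithinAt u (G (u t)) (Icc 0 T) t := by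
  have hP : IsPicardLindelof (fun _ : ℝ => G) (⟨0, left_mem_Icc.2 hT⟩ : Icc (0 : ℝ) T) x
      (M * T.toNNReal) 0 M K :=
    { lipschitzOnWith := fun _ _ => hG.lipschitzOnWith
      continuousOn := fun _ _ => continuousOn_const
      norm_le := fun _ _ y _ => hM y
      mul_max_le := by simp [hT] }
  exact hP.exists_eq_forall_mem_Icc_hasDerivWithinAt₀

theorem norm_smul_add_smul_le {E : Type*} [NormedAddCommGroup E] [NormedSpace ℝ E] {v w : E}
    (hv : ‖v‖ = 1) (hw : ‖w‖ = 1) (a b : ℝ) : ‖a • v + b • w‖ ≤ |a| + |b| :=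
  (norm_add_le _ _).trans_eq (by simp [norm_smul, hv, hw])

theorem le_infDist_iface {v w : E3} (hw : ‖w‖ = 1) (hwv : ⟪w, v⟫ = 0) (a b : ℝ) :
    b ≤ Metric.infDist (a • v + b • w) (iface v) := by
  refine (Metric.le_infDist (s := iface v) ⟨0, 0, by simp⟩).2 ?_
  rintro _ ⟨t, rfl⟩
  have h : ⟪w, a • v + b • w - t • v⟫ = b := by
    simp [inner_sub_right, inner_add_right, inner_smul_right, hwv, hw]
  calc b = ⟪w, a • v + b • w - t • v⟫ := h.symm
    _ ≤ ‖w‖ * ‖a • v + b • w - t • v‖ := real_inner_le_norm _ _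
    _ = dist (a • v + b • w) (t • v) := by rw [hw, one_mul, dist_eq_norm]

/-- A vector field on a half-plane which is bounded, Lipschitz and tangent to the plane has an
integral curve on `[0, T]` once it is extended constantly across the interface in the normal
direction; the curve is given in the coordinates of the plane. -/
theorem exists_integral_curve_coords {v w : E3} (hv : ‖v‖ = 1) (hw : ‖w‖ = 1) (hwv : ⟪w, v⟫ = 0)
    {g : E3 → E3} {K M : NNReal}
    (hplane : ∀ x ∈ halfPlane v w, ∃ c d : ℝ, g x = c • v + d • w)
    (hbdd : ∀ x ∈ halfPlane v w, ‖g x‖ ≤ M)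
    (hlip : ∀ x ∈ halfPlane v w, ∀ y ∈ halfPlane v w, ‖g x - g y‖ ≤ K * ‖x - y‖)
    (a b : ℝ) {T : ℝ} (hT : 0 ≤ T) :
    ∃ p q : ℝ → ℝ, p 0 = a ∧ q 0 = b ∧ ∀ t ∈ Icc 0 T,
      HasDerivWithinAt p ⟪v, g (p t • v + max (q t) 0 • w)⟫ (Icc 0 T) t ∧
      HasDerivWithinAt q ⟪w, g (p t • v + max (q t) 0 • w)⟫ (Icc 0 T) t ∧
      HasDerivWithinAt (fun s => p s • v + q s • w) (g (p t • v + max (q t) 0 • w))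
        (Icc 0 T) t := by
  set P : ℝ × ℝ → E3 := fun z => z.1 • v + max z.2 0 • w with hPdef
  have hP : ∀ z, P z ∈ halfPlane v w := fun z => ⟨z.1, max z.2 0, le_max_right _ _, rfl⟩
  have hPlip : ∀ z z', ‖P z - P z'‖ ≤ 2 * ‖z - z'‖ := by
    intro z z'
    have h1 : P z - P z' = (z.1 - z'.1) • v + (max z.2 0 - max z'.2 0) • w := by
      simp only [hPdef]; module
    have h2 : |max z.2 0 - max z'.2 0| ≤ |z.2 - z'.2| := abs_max_sub_max_le_abs _ _ _
    have h3 : |z.1 - z'.1| ≤ ‖z - z'‖ := norm_fst_le (z - z')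
    have h4 : |z.2 - z'.2| ≤ ‖z - z'‖ := norm_snd_le (z - z')
    rw [h1]
    linarith [norm_smul_add_smul_le hv hw (z.1 - z'.1) (max z.2 0 - max z'.2 0)]
  have hinner : ∀ {e : E3}, ‖e‖ = 1 → ∀ x, |⟪e, x⟫| ≤ ‖x‖ := fun {e} he x => by
    simpa [he] using abs_real_inner_le_norm e x
  have hG : LipschitzWith (K * 2) fun z => (⟪v, g (P z)⟫, ⟪w, g (P z)⟫) := by
    refine LipschitzWith.of_dist_le_mul fun z z' => ?_
    have h : ‖g (P z) - g (P z')‖ ≤ (K * 2 : NNReal) * dist z z' := by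
      refine (hlip _ (hP z) _ (hP z')).trans ?_
      rw [NNReal.coe_mul, mul_assoc, dist_eq_norm]
      exact mul_le_mul_of_nonneg_left (hPlip z z') K.coe_nonneg
    rw [dist_eq_norm, Prod.mk_sub_mk, ← inner_sub_right, ← inner_sub_right]
    exact max_le ((hinner hv _).trans h) ((hinner hw _).trans h)
  obtain ⟨u, hu0, hu⟩ := exists_hasDerivWithinAt_Icc_of_lipschitzWith hG (M := M)
    (fun z => max_le ((hinner hv _).trans (hbdd _ (hP z))) ((hinner hw _).trans (hbdd _ (hP z))))
    hT (a, b)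
  refine ⟨fun t => (u t).1, fun t => (u t).2, by simp [hu0], by simp [hu0], fun t ht => ?_⟩
  have hp : HasDerivWithinAt (fun t => (u t).1) ⟪v, g (P (u t))⟫ (Icc 0 T) t :=
    (ContinuousLinearMap.fst ℝ ℝ ℝ).hasFDerivAt.comp_hasDerivWithinAt t (hu t ht)
  have hq : HasDerivWithinAt (fun t => (u t).2) ⟪w, g (P (u t))⟫ (Icc 0 T) t :=
    (ContinuousLinearMap.snd ℝ ℝ ℝ).hasFDerivAt.comp_hasDerivWithinAt t (hu t ht)
  refine ⟨hp, hq, ?_⟩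
  have hsplit : g (P (u t)) = ⟪v, g (P (u t))⟫ • v + ⟪w, g (P (u t))⟫ • w := by
    obtain ⟨c, d, hcd⟩ := hplane _ (hP (u t))
    have hvw : ⟪v, w⟫ = 0 := by rw [real_inner_comm, hwv]
    simp [hcd, inner_add_right, inner_smul_right, hv, hw, hwv, hvw]
  change HasDerivWithinAt _ (g (P (u t))) _ _
  rw [hsplit]
  exact (hp.smul_const v).add (hq.smul_const w)

/-- If the normal component of a bounded Lipschitz field is `-δ` at the foot of a point close
enough to the interface, then the integral curve from that point reaches the interface in time
at most `2 / δ` times the distance. -/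
theorem exists_trajectory_to_iface {v w : E3} (hv : ‖v‖ = 1) (hw : ‖w‖ = 1) (hwv : ⟪w, v⟫ = 0)
    {g : E3 → E3} {K M : NNReal}
    (hplane : ∀ x ∈ halfPlane v w, ∃ c d : ℝ, g x = c • v + d • w)
    (hbdd : ∀ x ∈ halfPlane v w, ‖g x‖ ≤ M)
    (hlip : ∀ x ∈ halfPlane v w, ∀ y ∈ halfPlane v w, ‖g x - g y‖ ≤ K * ‖x - y‖)
    {a b δ : ℝ} (hδ : 0 < δ) (hb : 0 < b) (hg : ⟪w, g (a • v)⟫ = -δ)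
    (hsmall : K * (b + 2 * (M * (2 / δ * b))) ≤ δ / 2) :
    ∃ τ : ℝ, 0 < τ ∧ τ ≤ 2 / δ * b ∧ ∃ y : ℝ → E3,
      LipschitzOnWith M y (Icc 0 τ) ∧ y 0 = a • v + b • w ∧
      (∀ t ∈ Icc (0 : ℝ) τ, y t ∈ halfPlane v w) ∧
      (∀ t ∈ Ioo (0 : ℝ) τ, HasDerivAt y (g (y t)) t) ∧ y τ ∈ iface v := by
  set T := 2 / δ * b with hTdef
  have hT : 0 < T := by positivity
  obtain ⟨p, q, hp0, hq0, hpq⟩ :=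
    exists_integral_curve_coords hv hw hwv hplane hbdd hlip a b hT.le
  have hmem : ∀ t, p t • v + max (q t) 0 • w ∈ halfPlane v w :=
    fun t => ⟨_, _, le_max_right _ _, rfl⟩
  have h0 : (0 : ℝ) ∈ Icc 0 T := left_mem_Icc.2 hT.le
  have hdisp : ∀ {h : ℝ → ℝ} {e : E3}, ‖e‖ = 1 →
      (∀ t ∈ Icc 0 T, HasDerivWithinAt h ⟪e, g (p t • v + max (q t) 0 • w)⟫ (Icc 0 T) t) →
      ∀ t ∈ Icc 0 T, |h t - h 0| ≤ M * T := by
    intro h e he hh t ht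
    have hle := (convex_Icc (0 : ℝ) T).norm_image_sub_le_of_norm_hasDerivWithin_le (C := M) hh
      (fun s _ => (by simpa [he] using norm_inner_le_norm (𝕜 := ℝ) e _ :
        ‖⟪e, g (p s • v + max (q s) 0 • w)⟫‖ ≤ _).trans (hbdd _ (hmem s))) h0 ht
    refine (Real.norm_eq_abs _ ▸ hle).trans (mul_le_mul_of_nonneg_left ?_ M.coe_nonneg)
    simpa [abs_of_nonneg ht.1] using ht.2
  have hspeed : ∀ t ∈ Icc 0 T, ⟪w, g (p t • v + max (q t) 0 • w)⟫ ≤ -(δ / 2) := by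
    intro t ht
    have hpt := hdisp hv (fun s hs => (hpq s hs).1) t ht
    have hqt := hdisp hw (fun s hs => (hpq s hs).2.1) t ht
    rw [hp0] at hpt
    rw [hq0] at hqt
    have hmax : |max (q t) 0| ≤ b + M * T := by
      rw [abs_of_nonneg (le_max_right _ _)]
      exact max_le (by linarith [(abs_le.1 hqt).2]) (by positivity)
    have hnorm : ‖p t • v + max (q t) 0 • w - a • v‖ ≤ b + 2 * (M * T) := by
      have : p t • v + max (q t) 0 • w - a • v = (p t - a) • v + max (q t) 0 • w := by module
      rw [this]
      linarith [norm_smul_add_smul_le hv hw (p t - a) (max (q t) 0)]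
    have hdiff := hlip _ (hmem t) (a • v) ⟨a, 0, le_rfl, by simp⟩
    have hin := real_inner_le_norm w (g (p t • v + max (q t) 0 • w) - g (a • v))
    rw [inner_sub_right, hg, hw, one_mul] at hin
    linarith [mul_le_mul_of_nonneg_left hnorm K.coe_nonneg]
  have hqcont : ContinuousOn q (Icc 0 T) := fun t ht => (hpq t ht).2.1.continuousWithinAt
  have hanti : AntitoneOn (fun t => q t + δ / 2 * t) (Icc 0 T) := by
    refine antitoneOn_of_hasDerivWithinAt_nonpos (convex_Icc _ _) (by fun_prop)
      (f' := fun t => ⟪w, g (p t • v + max (q t) 0 • w)⟫ + δ / 2 * 1) (fun t ht => ?_)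
      fun t ht => by linarith [hspeed t (interior_subset ht)]
    exact (((hpq t (interior_subset ht)).2.1.mono interior_subset).add
      ((hasDerivWithinAt_id t _).const_mul (δ / 2)))
  have hqT : q T ≤ 0 := by
    have h := hanti h0 (right_mem_Icc.2 hT.le) hT.le
    have : δ / 2 * T = b := by rw [hTdef]; field_simp
    simp only [hq0] at h
    linarith
  obtain ⟨τ, hτ, hqτ⟩ := intermediate_value_Icc' hT.le hqcont ⟨hqT, hq0 ▸ hb.le⟩
  have hτ0 : 0 < τ := hτ.1.lt_of_ne fun h => by rw [← h, hq0] at hqτ; exact hb.ne' hqτ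
  have hsub : Icc 0 τ ⊆ Icc 0 T := Icc_subset_Icc_right hτ.2
  have hqnn : ∀ t ∈ Icc 0 τ, 0 ≤ q t := by
    intro t ht
    have h := hanti (hsub ht) hτ ht.2
    simp only [hqτ] at h
    linarith [mul_le_mul_of_nonneg_left ht.2 hδ.le]
  refine ⟨τ, hτ0, hτ.2, fun t => p t • v + q t • w, ?_, by simp [hp0, hq0],
    fun t ht => ⟨_, _, hqnn t ht, rfl⟩, fun t ht => ?_, p τ, by simp [hqτ]⟩
  · exact ((convex_Icc (0 : ℝ) T).lipschitzOnWith_of_nnnorm_hasDerivWithin_le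
      (fun t ht => (hpq t ht).2.2) fun t _ => hbdd _ (hmem t)).mono hsub
  · have hd := (hpq t (hsub (Ioo_subset_Icc_self ht))).2.2
    rw [max_eq_left (hqnn t (Ioo_subset_Icc_self ht))] at hd
    exact hd.hasDerivAt (Icc_mem_nhds ht.1 (ht.2.trans_le hτ.2))

/-- Near the interface, an admissible trajectory reaches `Γ` in time at most
`C xᵢ`. -/
theorem stmt_15
    (N : ℕ) (hN : 2 ≤ N) (e0 : E3) (e : Fin N → E3)
    (he0 : ‖e0‖ = 1) (he : ∀ k, ‖e k‖ = 1)
    (heinj : Function.Injective e) (hee0 : ∀ k, e k ≠ e0)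
    (horth : ∀ k, ⟪e k, e0⟫ = 0)
    {A : Type} [MetricSpace A] (Ai : Fin N → Set A)
    (hAne : ∀ k, (Ai k).Nonempty) (hAcp : ∀ k, IsCompact (Ai k))
    (hAdisj : ∀ k l, k ≠ l → Disjoint (Ai k) (Ai l))
    (f : Fin N → E3 → A → E3) (Mf Lf : ℝ)
    (hfcont : ∀ k, ContinuousOn (fun q : E3 × A => f k q.1 q.2)
      ((halfPlane e0 (e k)) ×ˢ (Ai k)))
    (hfplane : ∀ k, ∀ x ∈ halfPlane e0 (e k), ∀ a ∈ Ai k,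
      ∃ c0 ci : ℝ, f k x a = c0 • e0 + ci • e k)
    (hfbdd : ∀ k, ∀ x ∈ halfPlane e0 (e k), ∀ a ∈ Ai k, ‖f k x a‖ ≤ Mf)
    (hflip : ∀ k, ∀ x ∈ halfPlane e0 (e k), ∀ y ∈ halfPlane e0 (e k), ∀ a ∈ Ai k,
      ‖f k x a - f k y a‖ ≤ Lf * ‖x - y‖)
    (ℓ : Fin N → E3 → A → ℝ) (Mℓ : ℝ) (ω : ℝ → ℝ)
    (hωmono : Monotone ω) (hω0 : ω 0 = 0)
    (hlcont : ∀ k, ContinuousOn (fun q : E3 × A => ℓ k q.1 q.2)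
      ((halfPlane e0 (e k)) ×ˢ (Ai k)))
    (hlbdd : ∀ k, ∀ x ∈ halfPlane e0 (e k), ∀ a ∈ Ai k, |ℓ k x a| ≤ Mℓ)
    (hlmod : ∀ k, ∀ x ∈ halfPlane e0 (e k), ∀ y ∈ halfPlane e0 (e k), ∀ a ∈ Ai k,
      |ℓ k x a - ℓ k y a| ≤ ω ‖x - y‖)
    (hH2 : ∀ k, ∀ x ∈ halfPlane e0 (e k),
      Convex ℝ {q : E3 × ℝ | ∃ a ∈ Ai k, q = (f k x a, ℓ k x a)})
    (δ : ℝ) (hδ : 0 < δ)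
    (htH3 : ∀ k, ∀ x ∈ iface e0, ∀ s ∈ Icc (-δ) δ,
      ∃ a ∈ Ai k, ⟪f k x a, e k⟫ = s)
 :
    ∃ r C : ℝ, 0 < r ∧ 0 < C ∧ ∀ i : Fin N, ∀ x0 xi : ℝ, 0 < xi →
      Metric.infDist (x0 • e0 + xi • e i) (iface e0) < r →
      ∃ τ : ℝ, 0 < τ ∧ τ ≤ C * xi ∧
        ∃ y : ℝ → E3, ∃ L : NNReal,
          LipschitzOnWith L y (Icc 0 τ) ∧ y 0 = x0 • e0 + xi • e i ∧
          (∀ t ∈ Icc (0 : ℝ) τ, y t ∈ halfPlane e0 (e i)) ∧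
          (∀ᵐ t ∂(volume.restrict (Ioo (0 : ℝ) τ)),
            ∃ a ∈ Ai i, HasDerivAt y (f i (y t) a) t) ∧
          y τ ∈ iface e0 := by
  set K := Lf.toNNReal
  set M := Mf.toNNReal
  set D : ℝ := (K + 1) * (1 + 2 * (M * (2 / δ))) with hD
  have hDpos : 0 < D := by positivity
  refine ⟨δ / 2 / D, 2 / δ, by positivity, by positivity, fun i a b hb hr => ?_⟩
  obtain ⟨c, hc, hfc⟩ := htH3 i (a • e0) ⟨a, rfl⟩ (-δ) ⟨le_rfl, by linarith⟩
  have hbr : b * D < δ / 2 :=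
    (lt_div_iff₀ hDpos).1 ((le_infDist_iface (he i) (horth i) a b).trans_lt hr)
  have hsmall : K * (b + 2 * (M * (2 / δ * b))) ≤ δ / 2 := by
    have : 0 ≤ b + 2 * (M * (2 / δ * b)) := by positivity
    have hexp : b * D = K * (b + 2 * (M * (2 / δ * b))) + (b + 2 * (M * (2 / δ * b))) := by
      rw [hD]; ring
    linarith
  obtain ⟨τ, hτ, hτle, y, hyL, hy0, hymem, hyder, hyτ⟩ :=
    exists_trajectory_to_iface (g := fun x => f i x c) he0 (he i) (horth i)
      (fun x hx => hfplane i x hx c hc)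
      (fun x hx => (hfbdd i x hx c hc).trans (Real.le_coe_toNNReal Mf))
      (fun x hx z hz => (hflip i x hx z hz c hc).trans
        (mul_le_mul_of_nonneg_right (Real.le_coe_toNNReal Lf) (norm_nonneg _)))
      hδ hb (by rw [real_inner_comm]; exact hfc) hsmall
  refine ⟨τ, hτ, hτle, y, M, hyL, hy0, hymem, ?_, hyτ⟩
  exact ae_restrict_of_forall_mem measurableSet_Ioo fun t ht => ⟨c, hc, hyder t ht⟩
end
end
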